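/- arXiv:2309.01665 — 13 statements merged into one kernel-verified Lean document; each statement's English description precedes it below -/
import Mathlib

section
/- Let d ≥ 2, 1 ≤ k ≤ d−1, and let α ∈ ℝ^d satisfy α_i ≥ α_{i+1} for all 1 ≤ i ≤ d−1. Let σ be a permutation of {1,…,d} that is strictly increasing on {1,…,k} and strictly increasing on {k+1,…,d}. Let 1 ≤ n ≤ d−1 and suppose σ(j) = n and σ(j′) = n+1 for some indices j ≤ k < j′. Let T_n denote the transposition of n and n+1, and let T_nσ be the permutation i ↦ T_n(σ(i)). Then: (1) h_k(σ) − h_k(T_nσ) = (j′ − j)·(α_n − α_{n+1}); and (2) ψ_k(σ) − ψ_k(T_nσ) = (d/(k(d−k)))·(α_n − α_{n+1}). -/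
/-- `h_k(w)`: the entropy of `diag(α_{w 1},…,α_{w d})` on the standard maximal
parabolic subgroup `P_k` of `SL_d(ℝ)`. -/
noncomputable def entk (d k : ℕ) (α : ℕ → ℝ) (w : ℕ → ℕ) : ℝ :=
    (∑ i ∈ Finset.Icc 1 k, ∑ j ∈ Finset.Icc 1 k, max (α (w i) - α (w j)) 0)
  + (∑ i ∈ Finset.Icc (k + 1) d, ∑ j ∈ Finset.Icc (k + 1) d, max (α (w i) - α (w j)) 0)
  + (∑ i ∈ Finset.Icc 1 k, ∑ j ∈ Finset.Icc (k + 1) d, max (α (w i) - α (w j)) 0)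

/-- `ψ_k(w) = (1/k) Σ_{i=1}^k α_{w i} − (1/(d−k)) Σ_{i=k+1}^d α_{w i}`. -/
noncomputable def psik (d k : ℕ) (α : ℕ → ℝ) (w : ℕ → ℕ) : ℝ :=
    (1 / (k : ℝ)) * ∑ i ∈ Finset.Icc 1 k, α (w i)
  - (1 / ((d : ℝ) - (k : ℝ))) * ∑ i ∈ Finset.Icc (k + 1) d, α (w i)

lemma sum_ind_eq (p q j : ℕ) (h1 : p ≤ j) (h2 : j ≤ q) :
    ∑ i ∈ Finset.Icc p q, (if i = j then (1 : ℝ) else 0) = 1 := by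
  rw [Finset.sum_ite_eq', if_pos (Finset.mem_Icc.2 ⟨h1, h2⟩)]

lemma sum_ind_gt (p q j : ℕ) (h1 : p ≤ j) (h2 : j ≤ q) :
    ∑ i ∈ Finset.Icc p q, (if j < i then (1 : ℝ) else 0) = (q : ℝ) - j := by
  rw [Finset.sum_boole]
  have : (Finset.Icc p q).filter (fun i => j < i) = Finset.Ioc j q := by
    ext x; simp only [Finset.mem_filter, Finset.mem_Icc, Finset.mem_Ioc]; omega
  rw [this, Nat.card_Ioc, Nat.cast_sub h2]

lemma sum_ind_lt (p q j : ℕ) (h1 : p ≤ j) (h2 : j ≤ q) :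
    ∑ i ∈ Finset.Icc p q, (if i < j then (1 : ℝ) else 0) = (j : ℝ) - p := by
  rw [Finset.sum_boole]
  have : (Finset.Icc p q).filter (fun i => i < j) = Finset.Ico p j := by
    ext x; simp only [Finset.mem_filter, Finset.mem_Icc, Finset.mem_Ico]; omega
  rw [this, Nat.card_Ico, Nat.cast_sub h1]

lemma dbl_sum (s t : Finset ℕ) (u v : ℕ → ℝ) :
    ∑ i ∈ s, ∑ l ∈ t, u i * v l = (∑ i ∈ s, u i) * ∑ l ∈ t, v l := by
  rw [Finset.sum_mul_sum]

/-- Effect of moving the value at `j` from `a` to `b` inside one block. -/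
lemma block_diff (p q j : ℕ) (h1 : p ≤ j) (h2 : j ≤ q) (f g : ℕ → ℝ) (lo hi : ℝ)
    (hlo : ∀ i, j < i → i ≤ q → f i ≤ lo) (hhi : ∀ i, p ≤ i → i < j → hi ≤ f i)
    (hf1 : lo ≤ f j) (hf2 : f j ≤ hi) (hg1 : lo ≤ g j) (hg2 : g j ≤ hi)
    (hg : ∀ i, p ≤ i → i ≤ q → i ≠ j → g i = f i) :
    ∑ i ∈ Finset.Icc p q, ∑ l ∈ Finset.Icc p q, max (f i - f l) 0
      - ∑ i ∈ Finset.Icc p q, ∑ l ∈ Finset.Icc p q, max (g i - g l) 0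
      = (f j - g j) * (((q : ℝ) - j) - (j - p)) := by
  have key : ∀ i ∈ Finset.Icc p q, ∀ l ∈ Finset.Icc p q,
      max (f i - f l) 0 - max (g i - g l) 0 =
      (f j - g j) * ((if i = j then (1 : ℝ) else 0) * (if j < l then (1 : ℝ) else 0)
        - (if i < j then (1 : ℝ) else 0) * (if l = j then (1 : ℝ) else 0)) := by
    intro i hi' l hl'
    rw [Finset.mem_Icc] at hi' hl'
    rcases lt_trichotomy i j with h | h | h <;> rcases lt_trichotomy l j with h' | h' | h'
    · simp [h, h', h.ne, h'.ne, h'.not_gt, hg i hi'.1 hi'.2 h.ne, hg l hl'.1 hl'.2 h'.ne]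
    · subst h'
      have := hhi i hi'.1 h
      rw [hg i hi'.1 hi'.2 h.ne, max_eq_left (by linarith), max_eq_left (by linarith)]
      simp [h, h.ne]
    · simp [h'.ne', h.ne, hg i hi'.1 hi'.2 h.ne, hg l hl'.1 hl'.2 h'.ne']
    · subst h
      have := hhi l hl'.1 h'
      rw [hg l hl'.1 hl'.2 h'.ne, max_eq_right (by linarith), max_eq_right (by linarith)]
      simp [h'.ne, h'.not_gt]
    · subst h; subst h'; simp
    · subst h
      have := hlo l h' hl'.2
      rw [hg l hl'.1 hl'.2 h'.ne', max_eq_left (by linarith), max_eq_left (by linarith)]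
      simp [h']
    · simp [h.ne', h'.ne, h'.not_gt, hg i hi'.1 hi'.2 h.ne', hg l hl'.1 hl'.2 h'.ne]
    · subst h'
      have := hlo i h hi'.2
      rw [hg i hi'.1 hi'.2 h.ne', max_eq_right (by linarith), max_eq_right (by linarith)]
      simp [h.ne', h.not_gt]
    · simp [h'.ne', h.ne', hg i hi'.1 hi'.2 h.ne', hg l hl'.1 hl'.2 h'.ne']
  simp only [← Finset.sum_sub_distrib]
  rw [Finset.sum_congr rfl fun i hi' => Finset.sum_congr rfl fun l hl' => key i hi' l hl']
  simp only [← Finset.mul_sum, Finset.sum_sub_distrib, ← Finset.sum_mul]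
  rw [sum_ind_eq p q j h1 h2, sum_ind_gt p q j h1 h2, sum_ind_lt p q j h1 h2]
  ring

lemma cross_diff (k d j j' : ℕ) (hj1 : 1 ≤ j) (hjk : j ≤ k) (hj'k : k + 1 ≤ j') (hj'd : j' ≤ d)
    (f g : ℕ → ℝ) (hab : f j' ≤ f j)
    (h1lo : ∀ i, j < i → i ≤ k → f i ≤ f j') (h1hi : ∀ i, 1 ≤ i → i < j → f j ≤ f i)
    (h2lo : ∀ i, j' < i → i ≤ d → f i ≤ f j') (h2hi : ∀ i, k + 1 ≤ i → i < j' → f j ≤ f i)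
    (hgj : g j = f j') (hgj' : g j' = f j)
    (hg : ∀ i, 1 ≤ i → i ≤ d → i ≠ j → i ≠ j' → g i = f i) :
    ∑ i ∈ Finset.Icc 1 k, ∑ l ∈ Finset.Icc (k + 1) d, max (f i - f l) 0
      - ∑ i ∈ Finset.Icc 1 k, ∑ l ∈ Finset.Icc (k + 1) d, max (g i - g l) 0
      = (f j - f j') * (((d : ℝ) - j') + (j - 1) + 1) := by
  have key : ∀ i ∈ Finset.Icc 1 k, ∀ l ∈ Finset.Icc (k + 1) d,
      max (f i - f l) 0 - max (g i - g l) 0 =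
      (f j - f j') * ((if i = j then (1 : ℝ) else 0) * (if j' < l then (1 : ℝ) else 0)
        + (if i < j then (1 : ℝ) else 0) * (if l = j' then (1 : ℝ) else 0)
        + (if i = j then (1 : ℝ) else 0) * (if l = j' then (1 : ℝ) else 0)) := by
    intro i hi' l hl'
    rw [Finset.mem_Icc] at hi' hl'
    by_cases h : i = j
    · subst h
      rcases lt_trichotomy l j' with h' | h' | h'
      · have := h2hi l hl'.1 h'
        rw [hgj, hg l (by omega) hl'.2 (by omega) h'.ne, max_eq_right (by linarith),
          max_eq_right (by linarith)]
        simp [h'.ne, h'.not_gt]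
      · subst h'
        rw [hgj, hgj', max_eq_left (by linarith), max_eq_right (by linarith)]
        simp
      · have := h2lo l h' hl'.2
        rw [hgj, hg l (by omega) hl'.2 (by omega) h'.ne', max_eq_left (by linarith),
          max_eq_left (by linarith)]
        simp [h'.ne', h']
    · have e := hg i hi'.1 (by omega) h (by omega)
      by_cases h' : l = j'
      · subst h'
        rcases lt_or_gt_of_ne h with h2 | h2
        · have := h1hi i hi'.1 h2
          rw [e, hgj', max_eq_left (by linarith), max_eq_left (by linarith)]
          simp [h, h2]
        · have := h1lo i h2 hi'.2
          rw [e, hgj', max_eq_right (by linarith), max_eq_right (by linarith)]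
          simp [h, h2.not_gt]
      · rw [e, hg l (by omega) hl'.2 (by omega) h']
        simp [h, h']
  simp only [← Finset.sum_sub_distrib]
  rw [Finset.sum_congr rfl fun i hi' => Finset.sum_congr rfl fun l hl' => key i hi' l hl']
  simp only [← Finset.mul_sum, Finset.sum_add_distrib, ← Finset.sum_mul]
  rw [sum_ind_eq 1 k j hj1 hjk, sum_ind_lt 1 k j hj1 hjk, sum_ind_eq (k + 1) d j' hj'k hj'd,
    sum_ind_gt (k + 1) d j' hj'k hj'd]
  push_cast
  ring

lemma single_diff (p q j : ℕ) (h1 : p ≤ j) (h2 : j ≤ q) (f g : ℕ → ℝ)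
    (hg : ∀ i, p ≤ i → i ≤ q → i ≠ j → g i = f i) :
    ∑ i ∈ Finset.Icc p q, f i - ∑ i ∈ Finset.Icc p q, g i = f j - g j := by
  rw [← Finset.sum_sub_distrib]
  apply Finset.sum_eq_single_of_mem j (Finset.mem_Icc.2 ⟨h1, h2⟩)
  intro i hi hne
  rw [Finset.mem_Icc] at hi
  rw [hg i hi.1 hi.2 hne, sub_self]

/-- Effect of a simple transposition `T_n` on `h_k` and `ψ_k`:
if `σ(j) = n`, `σ(j′) = n+1` with `j ≤ k < j′`, then
`h_k(σ) − h_k(T_nσ) = (j′−j)(α_n − α_{n+1})` and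
`ψ_k(σ) − ψ_k(T_nσ) = (d/(k(d−k)))(α_n − α_{n+1})`. -/
theorem stmt_2 (d k n j j' : ℕ) (hd : 2 ≤ d) (hk1 : 1 ≤ k) (hkd : k ≤ d - 1)
    (α : ℕ → ℝ) (hmono : ∀ i ∈ Finset.Icc 1 (d - 1), α (i + 1) ≤ α i)
    (σ : Equiv.Perm ℕ) (hσmap : ∀ i ∈ Finset.Icc 1 d, σ i ∈ Finset.Icc 1 d)
    (hinc1 : ∀ i i', 1 ≤ i → i < i' → i' ≤ k → σ i < σ i')
    (hinc2 : ∀ i i', k + 1 ≤ i → i < i' → i' ≤ d → σ i < σ i')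
    (hn1 : 1 ≤ n) (hnd : n ≤ d - 1)
    (hj1 : 1 ≤ j) (hjk : j ≤ k) (hj'k : k < j') (hj'd : j' ≤ d)
    (hσj : σ j = n) (hσj' : σ j' = n + 1) :
    entk d k α ⇑σ - entk d k α (fun i => Equiv.swap n (n + 1) (σ i))
        = ((j' : ℝ) - (j : ℝ)) * (α n - α (n + 1))
    ∧ psik d k α ⇑σ - psik d k α (fun i => Equiv.swap n (n + 1) (σ i))
        = ((d : ℝ) / ((k : ℝ) * ((d : ℝ) - (k : ℝ)))) * (α n - α (n + 1)) := by
  have anti : ∀ m l : ℕ, 1 ≤ m → m ≤ l → l ≤ d → α l ≤ α m := by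
    intro m l hm hml
    induction l, hml using Nat.le_induction with
    | base => intro _; exact le_rfl
    | succ l hl ih =>
      intro h
      exact (hmono l (Finset.mem_Icc.2 ⟨by omega, by omega⟩)).trans (ih (by omega))
  have rng : ∀ i, 1 ≤ i → i ≤ d → 1 ≤ σ i ∧ σ i ≤ d := fun i h1 h2 =>
    Finset.mem_Icc.1 (hσmap i (Finset.mem_Icc.2 ⟨h1, h2⟩))
  have nen : ∀ i, i ≠ j → σ i ≠ n := fun i h e => h (σ.injective (e.trans hσj.symm))
  have nen' : ∀ i, i ≠ j' → σ i ≠ n + 1 := fun i h e => h (σ.injective (e.trans hσj'.symm))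
  obtain ⟨f, hf⟩ : ∃ f : ℕ → ℝ, ∀ i, f i = α (σ i) := ⟨_, fun _ => rfl⟩
  obtain ⟨g, hgd⟩ : ∃ g : ℕ → ℝ, ∀ i, g i = α (Equiv.swap n (n + 1) (σ i)) :=
    ⟨_, fun _ => rfl⟩
  have fj : f j = α n := by rw [hf, hσj]
  have fj' : f j' = α (n + 1) := by rw [hf, hσj']
  have gj : g j = f j' := by rw [hgd, fj', hσj, Equiv.swap_apply_left]
  have gj' : g j' = f j := by rw [hgd, fj, hσj', Equiv.swap_apply_right]
  have hg : ∀ i, 1 ≤ i → i ≤ d → i ≠ j → i ≠ j' → g i = f i := by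
    intro i _ _ h h'
    rw [hgd, hf, Equiv.swap_apply_of_ne_of_ne (nen i h) (nen' i h')]
  have hab : f j' ≤ f j := by
    rw [fj, fj']; exact anti _ _ hn1 (by omega) (by omega)
  have h1lo : ∀ i, j < i → i ≤ k → f i ≤ f j' := by
    intro i h1 h2
    have := hinc1 j i hj1 h1 h2
    rw [hf, fj']
    exact anti _ _ (by omega) (by omega) (rng i (by omega) (by omega)).2
  have h1hi : ∀ i, 1 ≤ i → i < j → f j ≤ f i := by
    intro i h1 h2
    have := hinc1 i j h1 h2 hjk
    rw [hf i, fj]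
    exact anti _ _ (rng i (by omega) (by omega)).1 (by omega) (by omega)
  have h2lo : ∀ i, j' < i → i ≤ d → f i ≤ f j' := by
    intro i h1 h2
    have := hinc2 j' i hj'k h1 h2
    rw [hf, fj']
    exact anti _ _ (by omega) (by omega) (rng i (by omega) (by omega)).2
  have h2hi : ∀ i, k + 1 ≤ i → i < j' → f j ≤ f i := by
    intro i h1 h2
    have := hinc2 i j' h1 h2 hj'd
    have := nen i (by omega)
    rw [hf i, fj]
    exact anti _ _ (rng i (by omega) (by omega)).1 (by omega) (by omega)
  have hgA : ∀ i, 1 ≤ i → i ≤ k → i ≠ j → g i = f i := fun i h1 h2 h3 =>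
    hg i h1 (by omega) h3 (by omega)
  have hgB : ∀ i, k + 1 ≤ i → i ≤ d → i ≠ j' → g i = f i := fun i h1 h2 h3 =>
    hg i (by omega) h2 (by omega) h3
  have hΔ : α n - α (n + 1) = f j - f j' := by rw [fj, fj']
  have hkR : (k : ℝ) ≠ 0 := by
    have : 0 < k := hk1
    positivity
  have hdR : (d : ℝ) - k ≠ 0 := by
    have : (k : ℝ) < d := by exact_mod_cast (by omega : k < d)
    linarith
  rw [hΔ]
  constructor
  · have B1 := block_diff 1 k j hj1 hjk f g (f j') (f j) h1lo h1hi hab le_rfl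
      (by rw [gj]) (by rw [gj]; exact hab) hgA
    have B2 := block_diff (k + 1) d j' hj'k hj'd f g (f j') (f j) h2lo h2hi le_rfl hab
      (by rw [gj']; exact hab) (by rw [gj']) hgB
    have C := cross_diff k d j j' hj1 hjk hj'k hj'd f g hab h1lo h1hi h2lo h2hi gj gj' hg
    rw [gj] at B1
    rw [gj'] at B2
    push_cast at B1 B2
    simp only [entk, ← hf, ← hgd]
    linear_combination B1 + B2 + C
  · have S1 := single_diff 1 k j hj1 hjk f g hgA
    have S2 := single_diff (k + 1) d j' hj'k hj'd f g hgB
    rw [gj] at S1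
    rw [gj'] at S2
    simp only [psik, ← hf, ← hgd]
    have e : (d : ℝ) / (k * ((d : ℝ) - k)) = 1 / k + 1 / ((d : ℝ) - k) := by
      field_simp
      ring
    rw [e]
    linear_combination (1 / (k : ℝ)) * S1 - (1 / ((d : ℝ) - k)) * S2
end

section
/- Let d ≥ 2, let 1 ≤ k ≤ d/2 be an integer, and let α ∈ ℝ^d satisfy α_i ≥ α_{i+1} for all 1 ≤ i ≤ d−1 and Σ_{i=1}^d α_i = 0. Then for every real number c with 1 ≤ c ≤ d−1 and every permutation w of {1,…,d}: h_k(w) − (k(d−k)/d)·c·ψ_k(w) ≤ h_k(τ^{⌊c⌋+1}) − (k(d−k)/d)·c·ψ_k(τ^{⌊c⌋+1}). (This expresses that the explicit extremal permutations τ^1,…,τ^d form the upper component of the boundary of the convex hull of the points (ψ_k(w), h_k(w)), w ∈ W: any line of slope (k(d−k)/d)c through the point corresponding to τ^{⌊c⌋+1} bounds all these points from above.) -/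
open Finset in
lemma aux_rep (α : ℕ → ℝ) (a : ℕ) (ha : 1 ≤ a) (d : ℕ) (had : a ≤ d) :
    α a = α d + ∑ t ∈ Ico 1 d, (α t - α (t + 1)) * (if a ≤ t then 1 else 0) := by
  induction d, had using Nat.le_induction with
  | base =>
    rw [Finset.sum_eq_zero]
    · simp
    · intro t ht
      rw [Finset.mem_Ico] at ht
      rw [if_neg (by omega)]; simp
  | succ n hn ih =>
    rw [Finset.sum_Ico_succ_top (by omega), if_pos hn]
    linarith

open Finset in
lemma aux_max (α : ℕ → ℝ) (d : ℕ) (hδ : ∀ t ∈ Ico 1 d, 0 ≤ α t - α (t + 1))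
    (a b : ℕ) (ha : a ∈ Icc 1 d) (hb : b ∈ Icc 1 d) :
    max (α a - α b) 0 = ∑ t ∈ Ico 1 d, (α t - α (t + 1)) *
      ((if a ≤ t then 1 else 0) * (1 - if b ≤ t then 1 else 0)) := by
  rw [Finset.mem_Icc] at ha hb
  have e : α a - α b = ∑ t ∈ Ico 1 d, (α t - α (t + 1)) *
      ((if a ≤ t then 1 else 0) - (if b ≤ t then 1 else 0)) := by
    rw [aux_rep α a ha.1 d ha.2, aux_rep α b hb.1 d hb.2]
    simp only [mul_sub, Finset.sum_sub_distrib]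
    ring
  rcases le_total a b with h | h
  · rw [max_eq_left]
    · rw [e]
      refine Finset.sum_congr rfl fun t _ => ?_
      congr 1
      split_ifs <;> first | omega | norm_num
    · rw [e]
      refine Finset.sum_nonneg fun t ht => mul_nonneg (hδ t ht) ?_
      split_ifs <;> first | omega | norm_num
  · rw [max_eq_right]
    · symm
      refine Finset.sum_eq_zero fun t _ => ?_
      split_ifs <;> first | omega | norm_num
    · rw [e]
      refine Finset.sum_nonpos fun t ht => mul_nonpos_of_nonneg_of_nonpos (hδ t ht) ?_
      split_ifs <;> first | omega | norm_num

/-- number of `i ∈ s` with `w i ≤ t` -/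
def auxN (w : ℕ → ℕ) (s : Finset ℕ) (t : ℕ) : ℕ := (s.filter (fun i => w i ≤ t)).card

open Finset in
lemma auxN_cast (w : ℕ → ℕ) (s : Finset ℕ) (t : ℕ) :
    ∑ i ∈ s, (if w i ≤ t then (1 : ℝ) else 0) = auxN w s t := by
  rw [Finset.sum_boole]; rfl

open Finset in
lemma aux_dsum (α : ℕ → ℝ) (d : ℕ) (hδ : ∀ t ∈ Ico 1 d, 0 ≤ α t - α (t + 1))
    (w : ℕ → ℕ) (s u : Finset ℕ) (hs : ∀ i ∈ s, w i ∈ Icc 1 d) (hu : ∀ i ∈ u, w i ∈ Icc 1 d) :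
    ∑ i ∈ s, ∑ j ∈ u, max (α (w i) - α (w j)) 0
      = ∑ t ∈ Ico 1 d, (α t - α (t + 1)) * ((auxN w s t : ℝ) * ((u.card : ℝ) - auxN w u t)) := by
  have h1 : ∑ i ∈ s, ∑ j ∈ u, max (α (w i) - α (w j)) 0
      = ∑ i ∈ s, ∑ j ∈ u, ∑ t ∈ Ico 1 d, (α t - α (t + 1)) *
      ((if w i ≤ t then 1 else 0) * (1 - if w j ≤ t then 1 else 0)) :=
    Finset.sum_congr rfl fun i hi => Finset.sum_congr rfl fun j hj =>
      aux_max α d hδ _ _ (hs i hi) (hu j hj)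
  have h2 : ∀ t, (auxN w s t : ℝ) * ((u.card : ℝ) - auxN w u t)
      = ∑ i ∈ s, ∑ j ∈ u, ((if w i ≤ t then (1:ℝ) else 0) * (1 - if w j ≤ t then (1:ℝ) else 0)) := by
    intro t
    rw [← auxN_cast, ← auxN_cast, ← Finset.sum_mul_sum]
    simp
  rw [h1]
  simp only [h2, Finset.mul_sum]
  rw [Finset.sum_comm (s := Ico 1 d) (t := s)]
  refine Finset.sum_congr rfl fun i _ => ?_
  rw [Finset.sum_comm]

open Finset in
lemma aux_image (d : ℕ) (w : Equiv.Perm ℕ) (hw : ∀ i ∈ Icc 1 d, w i ∈ Icc 1 d) :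
    (Icc 1 d).image w = Icc 1 d := by
  apply Finset.eq_of_subset_of_card_le
  · intro x hx
    obtain ⟨i, hi, rfl⟩ := Finset.mem_image.1 hx
    exact hw i hi
  · rw [Finset.card_image_of_injective _ w.injective]

open Finset in
lemma aux_split {M : Type*} [AddCommMonoid M] (d k : ℕ) (hk : k ≤ d) (f : ℕ → M) :
    ∑ i ∈ Icc 1 d, f i = ∑ i ∈ Icc 1 k, f i + ∑ i ∈ Icc (k+1) d, f i := by
  rw [← Finset.sum_union]
  · congr 1
    ext x; simp only [Finset.mem_union, Finset.mem_Icc]; omega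
  · rw [Finset.disjoint_left]
    intro x; simp only [Finset.mem_Icc]; omega

open Finset in
lemma aux_cnt (d k : ℕ) (hk : k ≤ d) (w : Equiv.Perm ℕ) (hw : ∀ i ∈ Icc 1 d, w i ∈ Icc 1 d)
    (t : ℕ) (ht : t ≤ d) : auxN w (Icc 1 k) t + auxN w (Icc (k+1) d) t = t := by
  unfold auxN
  rw [Finset.card_filter, Finset.card_filter, ← aux_split d k hk]
  rw [← Finset.sum_image (f := fun x => if x ≤ t then 1 else 0) (g := w) (by
    intro x _ y _ h; exact w.injective h), aux_image d w hw, ← Finset.card_filter]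
  have : (Icc 1 d).filter (fun x => x ≤ t) = Icc 1 t := by
    ext x; simp only [Finset.mem_filter, Finset.mem_Icc]; omega
  rw [this]; simp

open Finset in
lemma aux_main (d k : ℕ) (hk1 : 1 ≤ k) (hk : k < d) (α : ℕ → ℝ)
    (hδ : ∀ t ∈ Ico 1 d, 0 ≤ α t - α (t + 1)) (hsum : ∑ i ∈ Icc 1 d, α i = 0) (c : ℝ)
    (w : Equiv.Perm ℕ) (hw : ∀ i ∈ Icc 1 d, w i ∈ Icc 1 d) :
    entk d k α ⇑w - ((k : ℝ) * ((d : ℝ) - (k : ℝ)) / (d : ℝ)) * c * psik d k α ⇑w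
      = (∑ t ∈ Ico 1 d, (α t - α (t + 1)) * ((t : ℝ) * (d - k - t) +
          ((t + k - c) * auxN w (Icc 1 k) t - (auxN w (Icc 1 k) t : ℝ) ^ 2))) - c * (k * α d) := by
  have hw1 : ∀ i ∈ Icc 1 k, w i ∈ Icc 1 d := fun i hi => hw i (by
    rw [Finset.mem_Icc] at *; omega)
  have hw2 : ∀ i ∈ Icc (k+1) d, w i ∈ Icc 1 d := fun i hi => hw i (by
    rw [Finset.mem_Icc] at *; omega)
  have hA : ∑ i ∈ Icc 1 k, α (w i) = k * α d +
      ∑ t ∈ Ico 1 d, (α t - α (t + 1)) * auxN w (Icc 1 k) t := by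
    have : ∑ i ∈ Icc 1 k, α (w i) = ∑ i ∈ Icc 1 k, (α d +
      ∑ t ∈ Ico 1 d, (α t - α (t + 1)) * (if w i ≤ t then 1 else 0)) :=
      Finset.sum_congr rfl fun i hi => by
        have := Finset.mem_Icc.1 (hw1 i hi)
        exact aux_rep α _ this.1 d this.2
    rw [this, Finset.sum_add_distrib, Finset.sum_comm]
    simp only [← auxN_cast, Finset.mul_sum]
    simp
  have hB : ∑ i ∈ Icc 1 k, α (w i) + ∑ i ∈ Icc (k+1) d, α (w i) = 0 := by
    rw [← aux_split d k hk.le (fun i => α (w i)), ← hsum]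
    conv_rhs => rw [← aux_image d w hw]
    rw [Finset.sum_image (by intro x _ y _ h; exact w.injective h)]
  have hpsi : ((k : ℝ) * ((d : ℝ) - (k : ℝ)) / (d : ℝ)) * c * psik d k α ⇑w
      = c * ∑ i ∈ Icc 1 k, α (w i) := by
    unfold psik
    rw [eq_neg_of_add_eq_zero_right hB]
    have h1 : (k : ℝ) ≠ 0 := by positivity
    have h2 : (d : ℝ) - k ≠ 0 := by
      have : (k : ℝ) < d := by exact_mod_cast hk
      linarith
    have h3 : (d : ℝ) ≠ 0 := by
      have : 0 < d := by omega
      positivity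
    field_simp
    ring
  rw [hpsi, hA]
  unfold entk
  rw [aux_dsum α d hδ w _ _ hw1 hw1, aux_dsum α d hδ w _ _ hw2 hw2, aux_dsum α d hδ w _ _ hw1 hw2]
  rw [mul_add, Finset.mul_sum, ← Finset.sum_add_distrib, ← Finset.sum_add_distrib, sub_add_eq_sub_sub,
    sub_right_comm, ← Finset.sum_sub_distrib]
  congr 1
  refine Finset.sum_congr rfl fun t ht => ?_
  have hc := aux_cnt d k hk.le w hw t (Finset.mem_Ico.1 ht).2.le
  have hc' : (auxN w (Icc (k+1) d) t : ℝ) = t - auxN w (Icc 1 k) t := by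
    rw [eq_sub_iff_add_eq, add_comm]; exact_mod_cast hc
  rw [hc']
  have e1 : ((Icc 1 k).card : ℝ) = k := by simp
  have e2 : ((Icc (k+1) d).card : ℝ) = d - k := by
    rw [Nat.card_Icc, Nat.cast_sub (by omega)]; push_cast; ring
  rw [e1, e2]
  ring


/-- The extremal permutations `τ^s` form the upper boundary of the convex hull
of `{(ψ_k(w), h_k(w))}`: for `1 ≤ c ≤ d−1` and any permutation `w`,
`h_k(w) − (k(d−k)/d)·c·ψ_k(w) ≤ h_k(τ^{⌊c⌋+1}) − (k(d−k)/d)·c·ψ_k(τ^{⌊c⌋+1})`,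
where `τ^s` (here with `s = ⌊c⌋+1`) is the unique permutation strictly increasing on
`{k+1,…,d}` with `τ^s(j) = max(j, min(2j+s−k−1, j+d−k))` for `1 ≤ j ≤ k`. -/
theorem stmt_3 (d k : ℕ) (hd : 2 ≤ d) (hk1 : 1 ≤ k) (hk2 : 2 * k ≤ d)
    (α : ℕ → ℝ) (hmono : ∀ i ∈ Finset.Icc 1 (d - 1), α (i + 1) ≤ α i)
    (hsum : ∑ i ∈ Finset.Icc 1 d, α i = 0)
    (c : ℝ) (hc1 : 1 ≤ c) (hcd : c ≤ (d : ℝ) - 1)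
    (τ : Equiv.Perm ℕ) (hτmap : ∀ i ∈ Finset.Icc 1 d, τ i ∈ Finset.Icc 1 d)
    (hτinc : ∀ i i', k + 1 ≤ i → i < i' → i' ≤ d → τ i < τ i')
    (hτval : ∀ j ∈ Finset.Icc 1 k,
      (τ j : ℤ) = max (j : ℤ)
        (min (2 * (j : ℤ) + ((⌊c⌋₊ : ℤ) + 1) - (k : ℤ) - 1) ((j : ℤ) + (d : ℤ) - (k : ℤ))))
    (w : Equiv.Perm ℕ) (hw : ∀ i ∈ Finset.Icc 1 d, w i ∈ Finset.Icc 1 d) :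
    entk d k α ⇑w - ((k : ℝ) * ((d : ℝ) - (k : ℝ)) / (d : ℝ)) * c * psik d k α ⇑w
      ≤ entk d k α ⇑τ - ((k : ℝ) * ((d : ℝ) - (k : ℝ)) / (d : ℝ)) * c * psik d k α ⇑τ := by
  have hk : k < d := by omega
  have hδ : ∀ t ∈ Finset.Ico 1 d, 0 ≤ α t - α (t + 1) := by
    intro t ht
    rw [Finset.mem_Ico] at ht
    have := hmono t (by rw [Finset.mem_Icc]; omega)
    linarith
  rw [aux_main d k hk1 hk α hδ hsum c w hw, aux_main d k hk1 hk α hδ hsum c τ hτmap]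
  refine sub_le_sub_right (Finset.sum_le_sum fun t ht => mul_le_mul_of_nonneg_left ?_ (hδ t ht)) _
  have htd := Finset.mem_Ico.1 ht
  have hn := aux_cnt d k hk.le w hw t htd.2.le
  have hn1 : auxN w (Finset.Icc 1 k) t ≤ k := by
    refine (Finset.card_filter_le _ _).trans ?_
    simp
  have hn2 : auxN w (Finset.Icc (k+1) d) t ≤ d - k := by
    refine (Finset.card_filter_le _ _).trans ?_
    simp
  have hm1 : ((⌊c⌋₊ : ℕ) : ℝ) ≤ c := Nat.floor_le (by linarith)
  have hm2 : c < (⌊c⌋₊ : ℕ) + 1 := Nat.lt_floor_add_one c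
  generalize (⌊c⌋₊ : ℕ) = m at *
  have hN : auxN τ (Finset.Icc 1 k) t
      = (min (min (k : ℤ) t) (max (max 0 (((t : ℤ) + k - m) / 2)) ((t : ℤ) + k - d))).toNat := by
    unfold auxN
    have : (Finset.Icc 1 k).filter (fun i => τ i ≤ t) = Finset.Icc 1
       (min (min (k : ℤ) t) (max (max 0 (((t : ℤ) + k - m) / 2)) ((t : ℤ) + k - d))).toNat := by
      ext j
      simp only [Finset.mem_filter, Finset.mem_Icc]
      constructor
      · rintro ⟨hj, hjt⟩
        have := hτval j (Finset.mem_Icc.2 hj)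
        omega
      · intro hj
        have hj' : 1 ≤ j ∧ j ≤ k := by omega
        have := hτval j (Finset.mem_Icc.2 hj')
        omega
    rw [this]; simp
  generalize auxN τ (Finset.Icc 1 k) t = N at *
  generalize auxN w (Finset.Icc 1 k) t = n at *
  generalize auxN w (Finset.Icc (k+1) d) t = n' at *
  suffices h : 0 ≤ ((n : ℝ) - N) * (n + N - (t + k - c)) by nlinarith
  rcases lt_trichotomy n N with h | h | h
  · have h1 : n + N + m + 1 ≤ t + k := by omega
    have h1' : (n : ℝ) + N + m + 1 ≤ t + k := by exact_mod_cast h1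
    have h2 : (n : ℝ) < N := by exact_mod_cast h
    apply mul_nonneg_of_nonpos_of_nonpos <;> linarith
  · subst h; simp
  · have h1 : t + k ≤ n + N + m := by omega
    have h1' : (t : ℝ) + k ≤ n + N + m := by exact_mod_cast h1
    have h2 : (N : ℝ) < n := by exact_mod_cast h
    apply mul_nonneg <;> linarith
end

section
/- Let d ≥ 2, let 1 ≤ k ≤ d/2 and 1 ≤ m ≤ d−2k+1 be integers, and let α ∈ ℝ^d satisfy α_i ≥ α_{i+1} for all 1 ≤ i ≤ d−1 and Σ_{i=1}^d α_i = 0. Let τ be the unique permutation of {1,…,d} with τ(j) = m + 2(j−1) for 1 ≤ j ≤ k which is strictly increasing on {k+1,…,d}. Then h_k(τ) − (k(d−k)/d)·(m+k−1)·ψ_k(τ) = h_G − k·Σ_{i=1}^m α_i − Σ_{i=1}^{k−1} (k−i)·(α_{m+2i−1} + α_{m+2i}). -/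
/-- `h_G = Σ_{1≤i,j≤d} (α_i − α_j)⁺`. -/
noncomputable def entG (d : ℕ) (α : ℕ → ℝ) : ℝ :=
  ∑ i ∈ Finset.Icc 1 d, ∑ j ∈ Finset.Icc 1 d, max (α i - α j) 0

open Finset in
theorem aux_prefix (n a : ℕ) (β : ℕ → ℝ) (ha : a ∈ Icc 1 n)
    (hanti : ∀ i j, 1 ≤ i → i ≤ j → j ≤ n → β j ≤ β i) :
    ∑ b ∈ Icc 1 n, max (β b - β a) 0 = ∑ b ∈ Icc 1 a, β b - a * β a := by
  rw [mem_Icc] at ha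
  have h1 : ∑ b ∈ Icc 1 a, max (β b - β a) 0 = ∑ b ∈ Icc 1 n, max (β b - β a) 0 := by
    apply sum_subset
    · intro x hx
      rw [mem_Icc] at *
      omega
    · intro x hx hx'
      rw [mem_Icc] at *
      apply max_eq_right
      have := hanti a x ha.1 (by omega) hx.2
      linarith
  rw [← h1]
  have h2 : ∑ b ∈ Icc 1 a, max (β b - β a) 0 = ∑ b ∈ Icc 1 a, (β b - β a) := by
    apply sum_congr rfl
    intro x hx
    rw [mem_Icc] at hx
    apply max_eq_left
    have := hanti x a hx.1 hx.2 ha.2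
    linarith
  rw [h2, sum_sub_distrib]
  simp

open Finset in
theorem aux_T (m K : ℕ) (α : ℕ → ℝ) :
    ∑ b ∈ Icc 1 (m + 2 * K), α b = ∑ b ∈ Icc 1 m, α b
      + ∑ i ∈ Icc 1 K, (α (m + 2 * i - 1) + α (m + 2 * i)) := by
  induction K with
  | zero => simp
  | succ K ih =>
    rw [sum_Icc_succ_top (by omega), ← add_assoc, ← ih,
      show m + 2 * (K + 1) = m + 2 * K + 1 + 1 by ring,
      sum_Icc_succ_top (by omega), sum_Icc_succ_top (by omega)]
    simp only [Nat.add_sub_cancel]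
    ring

open Finset in
theorem aux_ind (m K : ℕ) (α : ℕ → ℝ) :
    ∑ j ∈ Icc 1 K, ((∑ b ∈ Icc 1 (m + 2 * (j - 1)), α b
        - ((m + 2 * (j - 1) : ℕ) : ℝ) * α (m + 2 * (j - 1)))
      - (∑ l ∈ Icc 1 j, α (m + 2 * (l - 1)) - j * α (m + 2 * (j - 1))))
      + ((m : ℝ) + K - 1) * ∑ j ∈ Icc 1 K, α (m + 2 * (j - 1))
    = K * ∑ i ∈ Icc 1 m, α i
      + ∑ i ∈ Icc 1 (K - 1), ((K : ℝ) - i) * (α (m + 2 * i - 1) + α (m + 2 * i)) := by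
  induction K with
  | zero => simp
  | succ K ih =>
    have h1 : ∑ i ∈ Icc 1 (K - 1), ((K : ℝ) - i) * (α (m + 2 * i - 1) + α (m + 2 * i))
        = ∑ i ∈ Icc 1 K, ((K : ℝ) - i) * (α (m + 2 * i - 1) + α (m + 2 * i)) := by
      cases K with
      | zero => simp
      | succ n =>
        rw [sum_Icc_succ_top (by omega)]
        simp
    rw [h1] at ih
    have h2 : ∑ i ∈ Icc 1 K, (((K + 1 : ℕ) : ℝ) - i) * (α (m + 2 * i - 1) + α (m + 2 * i))
        = ∑ i ∈ Icc 1 K, ((K : ℝ) - i) * (α (m + 2 * i - 1) + α (m + 2 * i))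
          + ∑ i ∈ Icc 1 K, (α (m + 2 * i - 1) + α (m + 2 * i)) := by
      rw [← sum_add_distrib]
      apply sum_congr rfl
      intro x _
      push_cast
      ring
    have h3 := aux_T m K α
    rw [sum_Icc_succ_top (by omega), sum_Icc_succ_top (b := K) (f := fun j => α (m + 2 * (j - 1))) (by omega)]
    simp only [Nat.add_sub_cancel]
    rw [h2]
    push_cast at *
    linear_combination ih + h3

/-- For the permutation `τ` with `τ(j) = m + 2(j−1)` on `{1,…,k}`, strictly
increasing on `{k+1,…,d}`:
`h_k(τ) − (k(d−k)/d)(m+k−1)ψ_k(τ)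
  = h_G − k Σ_{i=1}^m α_i − Σ_{i=1}^{k−1} (k−i)(α_{m+2i−1}+α_{m+2i})`. -/
theorem stmt_4 (d k m : ℕ) (hd : 2 ≤ d) (hk1 : 1 ≤ k) (hk2 : 2 * k ≤ d)
    (hm1 : 1 ≤ m) (hm2 : m ≤ d - 2 * k + 1)
    (α : ℕ → ℝ) (hmono : ∀ i ∈ Finset.Icc 1 (d - 1), α (i + 1) ≤ α i)
    (hsum : ∑ i ∈ Finset.Icc 1 d, α i = 0)
    (τ : Equiv.Perm ℕ) (hτmap : ∀ i ∈ Finset.Icc 1 d, τ i ∈ Finset.Icc 1 d)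
    (hτinc : ∀ i i', k + 1 ≤ i → i < i' → i' ≤ d → τ i < τ i')
    (hτval : ∀ j ∈ Finset.Icc 1 k, τ j = m + 2 * (j - 1)) :
    entk d k α ⇑τ - ((k : ℝ) * ((d : ℝ) - (k : ℝ)) / (d : ℝ)) * ((m : ℝ) + (k : ℝ) - 1)
        * psik d k α ⇑τ
      = entG d α - (k : ℝ) * (∑ i ∈ Finset.Icc 1 m, α i)
        - ∑ i ∈ Finset.Icc 1 (k - 1), ((k : ℝ) - (i : ℝ)) * (α (m + 2 * i - 1) + α (m + 2 * i)) := by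
  have hanti : ∀ i j, 1 ≤ i → i ≤ j → j ≤ d → α j ≤ α i := by
    intro i j hi hij
    induction j, hij using Nat.le_induction with
    | base => intro _; exact le_rfl
    | succ j hj ih =>
      intro hjd
      exact (hmono j (Finset.mem_Icc.2 ⟨by omega, by omega⟩)).trans (ih (by omega))
  have himg : (Finset.Icc 1 d).image τ = Finset.Icc 1 d := by
    apply Finset.eq_of_subset_of_card_le
    · intro x hx
      obtain ⟨y, hy, rfl⟩ := Finset.mem_image.1 hx
      exact hτmap y hy
    · rw [Finset.card_image_of_injective _ τ.injective]
  have hre : ∀ f : ℕ → ℝ, ∑ i ∈ Finset.Icc 1 d, f i = ∑ i ∈ Finset.Icc 1 d, f (τ i) := by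
    intro f
    conv_lhs => rw [← himg]
    rw [Finset.sum_image (fun x _ y _ h => τ.injective h)]
  have hsplit : ∀ f : ℕ → ℝ, ∑ i ∈ Finset.Icc 1 d, f i
      = ∑ i ∈ Finset.Icc 1 k, f i + ∑ i ∈ Finset.Icc (k + 1) d, f i := by
    intro f
    rw [← Finset.sum_union]
    · congr 1
      ext x
      simp only [Finset.mem_union, Finset.mem_Icc]
      omega
    · rw [Finset.disjoint_left]
      intro x hx hx'
      rw [Finset.mem_Icc] at *
      omega
  have hG : entG d α = entk d k α τ
      + ∑ j ∈ Finset.Icc 1 k, ∑ i ∈ Finset.Icc (k + 1) d, max (α (τ i) - α (τ j)) 0 := by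
    rw [Finset.sum_comm]
    unfold entG entk
    rw [hre]
    simp_rw [hre (fun j => max (α (τ _) - α j) 0)]
    rw [hsplit]
    simp_rw [hsplit (fun j => max (α (τ _) - α (τ j)) 0)]
    rw [Finset.sum_add_distrib, Finset.sum_add_distrib]
    ring
  have hS : ∑ j ∈ Finset.Icc 1 k, α (τ j) = ∑ j ∈ Finset.Icc 1 k, α (m + 2 * (j - 1)) :=
    Finset.sum_congr rfl fun j hj => by rw [hτval j hj]
  have hD : ∑ j ∈ Finset.Icc 1 k, ∑ i ∈ Finset.Icc (k + 1) d, max (α (τ i) - α (τ j)) 0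
      = ∑ j ∈ Finset.Icc 1 k, ((∑ b ∈ Finset.Icc 1 (m + 2 * (j - 1)), α b
        - ((m + 2 * (j - 1) : ℕ) : ℝ) * α (m + 2 * (j - 1)))
      - (∑ l ∈ Finset.Icc 1 j, α (m + 2 * (l - 1)) - j * α (m + 2 * (j - 1)))) := by
    apply Finset.sum_congr rfl
    intro j hj
    have e1 := hsplit (fun i => max (α (τ i) - α (τ j)) 0)
    have e2 := hre (fun i => max (α i - α (τ j)) 0)
    have e3 := aux_prefix d (τ j) α (hτmap j (by rw [Finset.mem_Icc] at *; omega)) hanti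
    have e4 := aux_prefix k j (fun l => α (m + 2 * (l - 1))) hj (by
      intro i j hi hij hjk
      exact hanti _ _ (by omega) (by omega) (by omega))
    have e5 : ∑ i ∈ Finset.Icc 1 k, max (α (τ i) - α (τ j)) 0
        = ∑ i ∈ Finset.Icc 1 k, max (α (m + 2 * (i - 1)) - α (m + 2 * (j - 1))) 0 :=
      Finset.sum_congr rfl fun i hi => by rw [hτval i hi, hτval j hj]
    have e6 := hτval j hj
    beta_reduce at e1 e2 e4
    rw [← e2, e3, e5, e4, e6] at e1
    rw [e6]
    linarith
  have hpsi : ((k : ℝ) * ((d : ℝ) - (k : ℝ)) / (d : ℝ)) * ((m : ℝ) + (k : ℝ) - 1)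
        * psik d k α ⇑τ = ((m : ℝ) + k - 1) * ∑ j ∈ Finset.Icc 1 k, α (m + 2 * (j - 1)) := by
    have e1 := hre α
    rw [hsum, hsplit (fun i => α (τ i))] at e1
    have e2 : ∑ i ∈ Finset.Icc (k + 1) d, α (τ i) = - ∑ i ∈ Finset.Icc 1 k, α (τ i) := by
      linarith
    unfold psik
    rw [e2, hS]
    have hk0 : (k : ℝ) ≠ 0 := by
      have : k ≠ 0 := by omega
      exact_mod_cast this
    have hd0 : (d : ℝ) ≠ 0 := by
      have : d ≠ 0 := by omega
      exact_mod_cast this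
    have hdk : (d : ℝ) - k ≠ 0 := by
      have : (k : ℝ) < d := by
        have : k < d := by omega
        exact_mod_cast this
      linarith
    field_simp
    ring
  have hI := aux_ind m k α
  rw [hpsi, hG, hD]
  linarith
end

section
/- Let d ≥ 2, 1 ≤ k ≤ d−1 and α ∈ ℝ^d. For a permutation w of {1,…,d}, let w̃ be the permutation defined by w̃(j) = w(j+k) for 1 ≤ j ≤ d−k and w̃(j) = w(j−(d−k)) for d−k < j ≤ d. Then ψ_k(w) = −ψ_{d−k}(w̃), and for every real number C: h_k(w) − C·ψ_k(w) = h_{d−k}(w̃) − (k(d−k) − C)·ψ_{d−k}(w̃). -/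
/-- For `w̃` obtained from `w` by exchanging the first `k` and last `d−k` entries:
`ψ_k(w) = −ψ_{d−k}(w̃)`, and for every real `C`,
`h_k(w) − C·ψ_k(w) = h_{d−k}(w̃) − (k(d−k) − C)·ψ_{d−k}(w̃)`. -/
theorem stmt_6 (d k : ℕ) (hd : 2 ≤ d) (hk1 : 1 ≤ k) (hkd : k ≤ d - 1)
    (α : ℕ → ℝ)
    (w : Equiv.Perm ℕ) (hw : ∀ i ∈ Finset.Icc 1 d, w i ∈ Finset.Icc 1 d)
    (wt : ℕ → ℕ)
    (hwt1 : ∀ j, 1 ≤ j → j ≤ d - k → wt j = w (j + k))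
    (hwt2 : ∀ j, d - k < j → j ≤ d → wt j = w (j - (d - k))) :
    psik d k α ⇑w = - psik d (d - k) α wt
    ∧ ∀ C : ℝ, entk d k α ⇑w - C * psik d k α ⇑w
        = entk d (d - k) α wt - ((k : ℝ) * ((d : ℝ) - (k : ℝ)) - C) * psik d (d - k) α wt := by
  have e1 : ∀ f : ℕ → ℝ, ∑ j ∈ Finset.Icc 1 (d - k), f (wt j)
      = ∑ j ∈ Finset.Icc (k + 1) d, f (w j) := by
    intro f
    refine Finset.sum_bij' (fun j _ => j + k) (fun j _ => j - k) ?_ ?_ ?_ ?_ ?_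
    · intro a ha; simp only [Finset.mem_Icc] at ha ⊢; omega
    · intro a ha; simp only [Finset.mem_Icc] at ha ⊢; omega
    · intro a ha; simp only [Finset.mem_Icc] at ha ⊢; omega
    · intro a ha; simp only [Finset.mem_Icc] at ha ⊢; omega
    · intro a ha
      simp only [Finset.mem_Icc] at ha
      rw [hwt1 a ha.1 ha.2]
  have e2 : ∀ f : ℕ → ℝ, ∑ j ∈ Finset.Icc (d - k + 1) d, f (wt j)
      = ∑ j ∈ Finset.Icc 1 k, f (w j) := by
    intro f
    refine Finset.sum_bij' (fun j _ => j - (d - k)) (fun j _ => j + (d - k)) ?_ ?_ ?_ ?_ ?_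
    · intro a ha; simp only [Finset.mem_Icc] at ha ⊢; omega
    · intro a ha; simp only [Finset.mem_Icc] at ha ⊢; omega
    · intro a ha; simp only [Finset.mem_Icc] at ha ⊢; omega
    · intro a ha; simp only [Finset.mem_Icc] at ha ⊢; omega
    · intro a ha
      simp only [Finset.mem_Icc] at ha
      rw [hwt2 a (by omega) ha.2]
  have hc : ((d - k : ℕ) : ℝ) = (d : ℝ) - k := Nat.cast_sub (by omega)
  have hk0 : (k : ℝ) ≠ 0 := by
    have : k ≠ 0 := by omega
    exact_mod_cast this
  have hdk0 : (d : ℝ) - k ≠ 0 := by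
    rw [← hc]
    have : d - k ≠ 0 := by omega
    exact_mod_cast this
  have hpsi : psik d k α w = - psik d (d - k) α wt := by
    unfold psik
    rw [e1 α, e2 α, hc, sub_sub_cancel]
    ring
  have hcross : (∑ i ∈ Finset.Icc 1 k, ∑ j ∈ Finset.Icc (k + 1) d, max (α (w i) - α (w j)) 0)
      - (∑ i ∈ Finset.Icc (k + 1) d, ∑ j ∈ Finset.Icc 1 k, max (α (w i) - α (w j)) 0)
      = (k : ℝ) * ((d : ℝ) - k) * psik d k α w := by
    rw [Finset.sum_comm (s := Finset.Icc (k + 1) d), ← Finset.sum_sub_distrib]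
    have h1 : ∀ i ∈ Finset.Icc 1 k,
        (∑ j ∈ Finset.Icc (k + 1) d, max (α (w i) - α (w j)) 0)
        - (∑ j ∈ Finset.Icc (k + 1) d, max (α (w j) - α (w i)) 0)
        = ((d : ℝ) - k) * α (w i) - ∑ j ∈ Finset.Icc (k + 1) d, α (w j) := by
      intro i _
      rw [← Finset.sum_sub_distrib]
      have h2 : ∀ j ∈ Finset.Icc (k + 1) d,
          max (α (w i) - α (w j)) 0 - max (α (w j) - α (w i)) 0 = α (w i) - α (w j) := by
        intro j _
        rcases le_total (α (w i)) (α (w j)) with h | h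
        · rw [max_eq_right (by linarith), max_eq_left (by linarith)]; ring
        · rw [max_eq_left (by linarith), max_eq_right (by linarith)]; ring
      rw [Finset.sum_congr rfl h2, Finset.sum_sub_distrib, Finset.sum_const, Nat.card_Icc,
        nsmul_eq_mul, show d + 1 - (k + 1) = d - k by omega, hc]
    rw [Finset.sum_congr rfl h1, Finset.sum_sub_distrib, Finset.sum_const, Nat.card_Icc,
      nsmul_eq_mul, ← Finset.mul_sum, Nat.add_sub_cancel]
    unfold psik
    field_simp
  refine ⟨hpsi, fun C => ?_⟩
  have hent : entk d (d - k) α wt =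
      (∑ i ∈ Finset.Icc (k + 1) d, ∑ j ∈ Finset.Icc (k + 1) d, max (α (w i) - α (w j)) 0)
      + (∑ i ∈ Finset.Icc 1 k, ∑ j ∈ Finset.Icc 1 k, max (α (w i) - α (w j)) 0)
      + (∑ i ∈ Finset.Icc (k + 1) d, ∑ j ∈ Finset.Icc 1 k, max (α (w i) - α (w j)) 0) := by
    unfold entk
    congr 1
    · congr 1
      · rw [e1 (fun x => ∑ j ∈ Finset.Icc 1 (d - k), max (α x - α (wt j)) 0)]
        exact Finset.sum_congr rfl fun i _ => e1 (fun y => max (α (w i) - α y) 0)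
      · rw [e2 (fun x => ∑ j ∈ Finset.Icc (d - k + 1) d, max (α x - α (wt j)) 0)]
        exact Finset.sum_congr rfl fun i _ => e2 (fun y => max (α (w i) - α y) 0)
    · rw [e1 (fun x => ∑ j ∈ Finset.Icc (d - k + 1) d, max (α x - α (wt j)) 0)]
      exact Finset.sum_congr rfl fun i _ => e2 (fun y => max (α (w i) - α y) 0)
  have hp : psik d (d - k) α wt = - psik d k α w := by rw [hpsi, neg_neg]
  rw [hent, hp]
  unfold entk
  linear_combination hcross
end

section
/- Let d ≥ 2, let 1 ≤ k ≤ d/2 be an integer, and let α ∈ ℝ^d satisfy α_i ≥ α_{i+1} for all 1 ≤ i ≤ d−1 and Σ_{i=1}^d α_i = 0. Let m be any integer with 1 ≤ m ≤ d−2k+1 such that Σ_{i=1}^k α_{m+2(i−1)} ≥ 0 ≥ Σ_{i=1}^k α_{m+2i−1}. Then for every permutation w of {1,…,d}: h_{d−k}(w) − (k(d−k)/d)·(d−m−k+1)·ψ_{d−k}(w) ≤ h_G − k·Σ_{i=1}^m α_i − Σ_{i=1}^{k−1} (k−i)·(α_{m+2i−1} + α_{m+2i}). (This is the assertion in Theorem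 1.1 that the same upper bound holds for the cusp region of the complementary maximal parabolic P_{d−k}, with the transpose linear functional of coefficient k(d−k) − (k(d−k)/d)(m+k−1).) -/
open Finset in
lemma aux_rank (f : ℕ → ℝ) (S : Finset ℕ) :
    ∑ s ∈ S, f (#{u ∈ S | u ≤ s}) = ∑ j ∈ Icc 1 (#S), f j := by
  induction S using Finset.induction_on_max with
  | empty => simp
  | insert a S hS ih =>
    have ha : a ∉ S := fun h => lt_irrefl _ (hS a h)
    rw [sum_insert ha, card_insert_of_notMem ha, Finset.sum_Icc_succ_top (by omega), ← ih, add_comm]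
    congr 1
    · apply sum_congr rfl
      intro s hs
      congr 2
      ext u
      have := hS s hs
      simp only [mem_filter, mem_insert]
      constructor
      · rintro ⟨rfl | h, h2⟩
        · omega
        · exact ⟨h, h2⟩
      · rintro ⟨h, h2⟩
        exact ⟨Or.inr h, h2⟩
    · have : {u ∈ insert a S | u ≤ a} = insert a S := by
        apply filter_true_of_mem
        intro u hu
        rcases mem_insert.1 hu with rfl | h
        · exact le_rfl
        · exact (hS u h).le
      rw [this, card_insert_of_notMem ha]

open Finset in
lemma aux_tel (α : ℕ → ℝ) (m n : ℕ) :
    ∑ i ∈ Icc 1 (m + 2 * n), α i = ∑ i ∈ Icc 1 m, α i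
      + ∑ i ∈ Icc 1 n, (α (m + 2 * i - 1) + α (m + 2 * i)) := by
  induction n with
  | zero => simp
  | succ n ih =>
    rw [Finset.sum_Icc_succ_top (b := n) (by omega), show m + 2 * (n + 1) = m + 2 * n + 1 + 1 by ring,
      Finset.sum_Icc_succ_top (by omega), Finset.sum_Icc_succ_top (by omega), ih]
    simp only [Nat.add_sub_cancel]
    ring

open Finset in
lemma aux_main_s7 (α : ℕ → ℝ) (m n : ℕ) :
    ∑ j ∈ Icc 1 (n + 1), ∑ i ∈ Icc 1 (m + 2 * j - 2), α i
      = ((n + 1 : ℕ) : ℝ) * ∑ i ∈ Icc 1 m, α i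
      + ∑ i ∈ Icc 1 n, (((n + 1 : ℕ) : ℝ) - i) * (α (m + 2 * i - 1) + α (m + 2 * i)) := by
  induction n with
  | zero => simp
  | succ n ih =>
    rw [Finset.sum_Icc_succ_top (by omega), ih,
      show m + 2 * (n + 1 + 1) - 2 = m + 2 * (n + 1) by omega, aux_tel,
      Finset.sum_Icc_succ_top (b := n) (by omega), Finset.sum_Icc_succ_top (b := n) (by omega)]
    have : ∑ i ∈ Icc 1 n, (((n + 1 + 1 : ℕ) : ℝ) - i) * (α (m + 2 * i - 1) + α (m + 2 * i))
        = ∑ i ∈ Icc 1 n, (((n + 1 : ℕ) : ℝ) - i) * (α (m + 2 * i - 1) + α (m + 2 * i))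
          + ∑ i ∈ Icc 1 n, (α (m + 2 * i - 1) + α (m + 2 * i)) := by
      rw [← sum_add_distrib]
      apply sum_congr rfl
      intro i _
      push_cast
      ring
    rw [this]
    push_cast
    ring

open Finset in
lemma aux_split_s7 (α : ℕ → ℝ) (a b : ℕ) (h : a ≤ b) :
    ∑ i ∈ Icc 1 b, α i = ∑ i ∈ Icc 1 a, α i + ∑ i ∈ Ioc a b, α i := by
  rw [← sum_union]
  · apply sum_congr _ (fun _ _ => rfl)
    ext x
    simp only [mem_union, mem_Icc, mem_Ioc]
    omega
  · rw [disjoint_left]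
    intro x
    simp only [mem_Icc, mem_Ioc]
    omega

open Finset in
lemma aux_min (d : ℕ) (α : ℕ → ℝ)
    (ha : ∀ i j, 1 ≤ i → i ≤ j → j ≤ d → α j ≤ α i) (s p : ℕ)
    (hs : 1 ≤ s) (hsd : s ≤ d) (hp : 1 ≤ p) (hpd : p ≤ d) :
    ∑ i ∈ Icc 1 p, α i ≤ ((p : ℝ) - s) * α s + ∑ i ∈ Icc 1 s, α i := by
  rcases le_total s p with h | h
  · rw [aux_split_s7 α s p h]
    have : ∑ i ∈ Ioc s p, α i ≤ ∑ i ∈ Ioc s p, α s := by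
      apply sum_le_sum
      intro i hi
      rw [mem_Ioc] at hi
      exact ha _ _ hs (by omega) (by omega)
    rw [sum_const, Nat.card_Ioc, nsmul_eq_mul, Nat.cast_sub h] at this
    linarith
  · rw [aux_split_s7 α p s h]
    have : ∑ i ∈ Ioc p s, α s ≤ ∑ i ∈ Ioc p s, α i := by
      apply sum_le_sum
      intro i hi
      rw [mem_Ioc] at hi
      exact ha _ _ (by omega) (by omega) (by omega)
    rw [sum_const, Nat.card_Ioc, nsmul_eq_mul, Nat.cast_sub h] at this
    linarith

open Finset in
lemma aux_one (d : ℕ) (α : ℕ → ℝ) (S : Finset ℕ) (hS : S ⊆ Icc 1 d)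
    (hsum : ∑ i ∈ Icc 1 d, α i = 0) (s : ℕ) (hs : s ∈ S) :
    ((d : ℝ) - s) * α s + ∑ i ∈ Icc 1 s, α i - ((#S : ℝ) - #{u ∈ S | u ≤ s}) * α s
      + ∑ u ∈ S, (if s < u then α u else 0)
    ≤ ∑ t ∈ Icc 1 d \ S, max (α s - α t) 0 := by
  have hsd := mem_Icc.1 (hS hs)
  have h1 : ∑ t ∈ Icc 1 d \ S, (if s < t then α s - α t else 0)
      ≤ ∑ t ∈ Icc 1 d \ S, max (α s - α t) 0 := by
    apply sum_le_sum
    intro t _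
    split_ifs
    · exact le_max_left _ _
    · exact le_max_right _ _
  refine le_trans (le_of_eq ?_) h1
  have h2 := sum_sdiff (f := fun t => if s < t then α s - α t else 0) hS
  have h3 : ∑ t ∈ Icc 1 d, (if s < t then α s - α t else 0)
      = ∑ t ∈ Ioc s d, (α s - α t) := by
    rw [← sum_filter]
    apply sum_congr _ (fun _ _ => rfl)
    ext x
    simp only [mem_filter, mem_Icc, mem_Ioc]
    omega
  rw [sum_sub_distrib, sum_const, Nat.card_Ioc, nsmul_eq_mul, Nat.cast_sub hsd.2] at h3
  have h4 := aux_split_s7 α s d hsd.2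
  have h5 : ∑ t ∈ S, (if s < t then α s - α t else 0)
      = ((#S : ℝ) - #{u ∈ S | u ≤ s}) * α s - ∑ u ∈ S, (if s < u then α u else 0) := by
    have h6 : (#S : ℝ) = #{u ∈ S | u ≤ s} + #{u ∈ S | s < u} := by
      rw [← card_filter_add_card_filter_not (s := S) (fun u => u ≤ s)]
      push_cast
      simp only [not_le]
    rw [h6, ← sum_filter, ← sum_filter, sum_sub_distrib, sum_const, nsmul_eq_mul]
    ring
  linarith

open Finset in
lemma aux_all (d m : ℕ) (α : ℕ → ℝ) (S : Finset ℕ) (hS : S ⊆ Icc 1 d)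
    (ha : ∀ i j, 1 ≤ i → i ≤ j → j ≤ d → α j ≤ α i)
    (hm1 : 1 ≤ m) (hm2 : m + 2 * #S ≤ d + 1)
    (hsum : ∑ i ∈ Icc 1 d, α i = 0) :
    ∑ j ∈ Icc 1 (#S), ∑ i ∈ Icc 1 (m + 2 * j - 2), α i ≤
    ∑ s ∈ S, ∑ t ∈ Icc 1 d \ S, max (α s - α t) 0
      - ((d : ℝ) - m - #S + 1) * ∑ s ∈ S, α s := by
  rw [← aux_rank (fun j => ∑ i ∈ Icc 1 (m + 2 * j - 2), α i)]
  have h1 := sum_le_sum (fun s hs => aux_one d α S hS hsum s hs)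
  rw [sum_add_distrib, sum_comm (s := S) (t := S)] at h1
  have h2 : ∀ u ∈ S, ∑ s ∈ S, (if s < u then α u else 0) = ((#{v ∈ S | v ≤ u} : ℝ) - 1) * α u := by
    intro u hu
    have : {v ∈ S | v ≤ u} = insert u {v ∈ S | v < u} := by
      ext x
      simp only [mem_filter, mem_insert]
      constructor
      · rintro ⟨h, h2⟩
        rcases h2.eq_or_lt with h3 | h3
        · exact Or.inl h3
        · exact Or.inr ⟨h, h3⟩
      · rintro (rfl | h)
        · exact ⟨hu, le_rfl⟩
        · exact ⟨h.1, h.2.le⟩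
    rw [this, card_insert_of_notMem (by simp), ← sum_filter, sum_const, nsmul_eq_mul]
    push_cast
    ring
  rw [sum_congr rfl h2, ← sum_add_distrib] at h1
  rw [mul_sum]
  refine le_trans ?_ (sub_le_sub_right h1 _)
  rw [← sum_sub_distrib]
  apply sum_le_sum
  intro s hs
  have hsd := mem_Icc.1 (hS hs)
  have hr : #{u ∈ S | u ≤ s} ≤ #S := card_filter_le _ _
  have hr1 : 1 ≤ #{u ∈ S | u ≤ s} := card_pos.2 ⟨s, by simp [hs]⟩
  have := aux_min d α ha s (m + 2 * #{u ∈ S | u ≤ s} - 2) hsd.1 hsd.2 (by omega) (by omega)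
  refine this.trans (le_of_eq ?_)
  rw [Nat.cast_sub (by omega)]
  push_cast
  ring


/-- The same upper bound as for `P_k` holds for the complementary maximal
parabolic `P_{d−k}`, with the transposed linear functional: for every `w`,
`h_{d−k}(w) − (k(d−k)/d)(d−m−k+1)ψ_{d−k}(w)
  ≤ h_G − k Σ_{i=1}^m α_i − Σ_{i=1}^{k−1} (k−i)(α_{m+2i−1}+α_{m+2i})`. -/
theorem stmt_7 (d k m : ℕ) (hd : 2 ≤ d) (hk1 : 1 ≤ k) (hk2 : 2 * k ≤ d)
    (α : ℕ → ℝ) (hmono : ∀ i ∈ Finset.Icc 1 (d - 1), α (i + 1) ≤ α i)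
    (hsum : ∑ i ∈ Finset.Icc 1 d, α i = 0)
    (hm1 : 1 ≤ m) (hm2 : m ≤ d - 2 * k + 1)
    (hsgn1 : 0 ≤ ∑ i ∈ Finset.Icc 1 k, α (m + 2 * (i - 1)))
    (hsgn2 : ∑ i ∈ Finset.Icc 1 k, α (m + 2 * i - 1) ≤ 0)
    (w : Equiv.Perm ℕ) (hw : ∀ i ∈ Finset.Icc 1 d, w i ∈ Finset.Icc 1 d) :
    entk d (d - k) α ⇑w
        - ((k : ℝ) * ((d : ℝ) - (k : ℝ)) / (d : ℝ)) * ((d : ℝ) - (m : ℝ) - (k : ℝ) + 1)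
          * psik d (d - k) α ⇑w
      ≤ entG d α - (k : ℝ) * (∑ i ∈ Finset.Icc 1 m, α i)
        - ∑ i ∈ Finset.Icc 1 (k - 1), ((k : ℝ) - (i : ℝ)) * (α (m + 2 * i - 1) + α (m + 2 * i)) := by


  have ha : ∀ i j, 1 ≤ i → i ≤ j → j ≤ d → α j ≤ α i := by
    intro i j hi hij
    induction j, hij using Nat.le_induction with
    | base => intro _; exact le_rfl
    | succ j hj ih =>
      intro hjd
      exact (hmono j (Finset.mem_Icc.2 (by omega))).trans (ih (by omega))
  have hinj : Function.Injective (⇑w) := w.injective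
  have himg : (Finset.Icc 1 d).image w = Finset.Icc 1 d :=
    Finset.eq_of_subset_of_card_le
      (by
        intro x hx
        obtain ⟨i, hi, rfl⟩ := Finset.mem_image.1 hx
        exact hw i hi)
      (by rw [Finset.card_image_of_injective _ hinj])
  have hre : ∀ f : ℕ → ℝ, ∀ A : Finset ℕ, ∑ i ∈ A.image w, f i = ∑ i ∈ A, f (w i) :=
    fun f A => Finset.sum_image (fun x _ y _ h => hinj h)
  set B := Finset.Icc (d - k + 1) d with hB
  set A := Finset.Icc 1 (d - k) with hA
  have hAB : Finset.Icc 1 d = A ∪ B := by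
    ext x
    simp only [hA, hB, Finset.mem_union, Finset.mem_Icc]
    omega
  have hdis : Disjoint A B := by
    rw [Finset.disjoint_left]
    intro x
    simp only [hA, hB, Finset.mem_Icc]
    omega
  have hS : B.image w ⊆ Finset.Icc 1 d := by
    rw [← himg, hAB]
    exact Finset.image_subset_image Finset.subset_union_right
  have hT : Finset.Icc 1 d \ B.image w = A.image w := by
    rw [← himg, hAB, Finset.image_union, Finset.union_sdiff_cancel_right]
    exact (Finset.disjoint_image hinj).2 hdis
  have hcard : (B.image w).card = k := by
    rw [Finset.card_image_of_injective _ hinj, hB, Nat.card_Icc]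
    omega
  have key := aux_all d m α (B.image w) hS ha hm1 (by rw [hcard]; omega) hsum
  rw [hT, hcard, hre, hre] at key
  simp only [hre] at key
  have hG : entG d α = entk d (d - k) α w
      + ∑ s ∈ B, ∑ t ∈ A, max (α (w s) - α (w t)) 0 := by
    unfold entG entk
    rw [← himg]
    simp only [hre]
    rw [hAB]
    simp only [Finset.sum_union hdis, Finset.sum_add_distrib]
    ring
  have hz : ∑ i ∈ A, α (w i) + ∑ i ∈ B, α (w i) = 0 := by
    rw [← Finset.sum_union hdis, ← hAB, ← hre α, himg, hsum]
  have hd0 : (d : ℝ) ≠ 0 := by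
    have : d ≠ 0 := by omega
    exact_mod_cast this
  have hk0 : (k : ℝ) ≠ 0 := by
    have : k ≠ 0 := by omega
    exact_mod_cast this
  have hdk0 : (d : ℝ) - k ≠ 0 := by
    have : k < d := by omega
    have : (k : ℝ) < d := by exact_mod_cast this
    linarith
  have hpsi : (k : ℝ) * ((d : ℝ) - k) / d * psik d (d - k) α w = - ∑ i ∈ B, α (w i) := by
    unfold psik
    rw [Nat.cast_sub (by omega)]
    change (k : ℝ) * ((d : ℝ) - k) / d * (1 / ((d : ℝ) - k) * ∑ i ∈ A, α (w i)
      - 1 / ((d : ℝ) - (d - k)) * ∑ i ∈ B, α (w i)) = _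
    rw [show ∑ i ∈ A, α (w i) = - ∑ i ∈ B, α (w i) by linarith,
      show (d : ℝ) - (d - k) = k by ring]
    field_simp
    ring
  obtain ⟨n, rfl⟩ : ∃ n, k = n + 1 := ⟨k - 1, by omega⟩
  have hmn := aux_main_s7 α m n
  rw [hmn] at key
  rw [mul_right_comm, hpsi, hG, Nat.add_sub_cancel]
  linarith
end

section
/- Let d ≥ 2, let 1 ≤ k ≤ d/2 be an integer, and let α ∈ ℝ^d satisfy α_i ≥ α_{i+1} for all 1 ≤ i ≤ d−1 and Σ_{i=1}^d α_i = 0. Then there exists an integer m with 1 ≤ m ≤ d−2k+1 such that Σ_{i=1}^k α_{m+2(i−1)} ≥ 0 ≥ Σ_{i=1}^k α_{m+2i−1}. (This shows that the constant m_k appearing in Theorem 1.1 is well defined.) -/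
lemma aux_pair (α : ℕ → ℝ) (m k : ℕ) :
    ∑ j ∈ Finset.range (2 * k), α (m + j)
      = ∑ i ∈ Finset.range k, α (m + 2 * i) + ∑ i ∈ Finset.range k, α (m + 1 + 2 * i) := by
  induction k with
  | zero => simp
  | succ k ih =>
    rw [show 2 * (k + 1) = 2 * k + 1 + 1 by ring, Finset.sum_range_succ, Finset.sum_range_succ, ih,
      Finset.sum_range_succ, Finset.sum_range_succ,
      show m + (2 * k + 1) = m + 1 + 2 * k by ring]
    ring

lemma aux_anti (d : ℕ) (α : ℕ → ℝ) (hmono : ∀ i ∈ Finset.Icc 1 (d - 1), α (i + 1) ≤ α i)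
    (i j : ℕ) (hi : 1 ≤ i) (hij : i ≤ j) (hj : j ≤ d) : α j ≤ α i := by
  induction j, hij using Nat.le_induction with
  | base => exact le_rfl
  | succ n hn ih =>
    exact (hmono n (Finset.mem_Icc.2 ⟨by omega, by omega⟩)).trans (ih (by omega))

lemma aux_prefix_s8 (n r : ℕ) (α : ℕ → ℝ)
    (h : ∀ i j, 1 ≤ i → i ≤ j → j ≤ n + r → α j ≤ α i)
    (hs : ∑ j ∈ Finset.range n, α (1 + j) + ∑ j ∈ Finset.range r, α (1 + n + j) = 0) :
    0 ≤ ∑ j ∈ Finset.range n, α (1 + j) := by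
  rcases Nat.eq_zero_or_pos n with rfl | hn
  · simp
  rcases le_total 0 (α n) with h0 | h0
  · apply Finset.sum_nonneg
    intro i hi
    rw [Finset.mem_range] at hi
    exact h0.trans (h _ _ (by omega) (by omega) (by omega))
  · have : ∑ j ∈ Finset.range r, α (1 + n + j) ≤ 0 := by
      apply Finset.sum_nonpos
      intro i hi
      rw [Finset.mem_range] at hi
      exact (h n _ (by omega) (by omega) (by omega)).trans h0
    linarith

/-- Existence of the constant `m_k` of Theorem 1.1: for weakly decreasing `α`
summing to zero, there is `1 ≤ m ≤ d−2k+1` with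
`Σ_{i=1}^k α_{m+2(i−1)} ≥ 0 ≥ Σ_{i=1}^k α_{m+2i−1}`. -/
theorem stmt_8 (d k : ℕ) (hd : 2 ≤ d) (hk1 : 1 ≤ k) (hk2 : 2 * k ≤ d)
    (α : ℕ → ℝ) (hmono : ∀ i ∈ Finset.Icc 1 (d - 1), α (i + 1) ≤ α i)
    (hsum : ∑ i ∈ Finset.Icc 1 d, α i = 0) :
    ∃ m : ℕ, 1 ≤ m ∧ m ≤ d - 2 * k + 1 ∧
      0 ≤ ∑ i ∈ Finset.Icc 1 k, α (m + 2 * (i - 1)) ∧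
      ∑ i ∈ Finset.Icc 1 k, α (m + 2 * i - 1) ≤ 0 := by
  have hconv : ∀ (f : ℕ → ℝ) (n : ℕ),
      ∑ i ∈ Finset.Icc 1 n, f i = ∑ i ∈ Finset.range n, f (1 + i) := by
    intro f n
    rw [← Finset.Ico_add_one_right_eq_Icc, Finset.sum_Ico_eq_sum_range]
    simp
  obtain ⟨r, rfl⟩ := Nat.exists_eq_add_of_le hk2
  have hanti := aux_anti _ α hmono
  rw [hconv] at hsum
  have hS : ∀ m, 1 ≤ m → m ≤ r + 1 → ∑ i ∈ Finset.range k, α (m + 1 + 2 * i)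
      ≤ ∑ i ∈ Finset.range k, α (m + 2 * i) := by
    intro m h1 h2
    apply Finset.sum_le_sum
    intro i hi
    rw [Finset.mem_range] at hi
    exact hanti _ _ (by omega) (by omega) (by omega)
  have h1 : 0 ≤ ∑ j ∈ Finset.range (2 * k), α (1 + j) := by
    apply aux_prefix_s8 (2 * k) r α hanti
    rw [← hsum, Finset.sum_range_add]
    simp only [add_assoc]
  have h2 : ∑ j ∈ Finset.range (2 * k), α (r + 1 + j) ≤ 0 := by
    have hs : ∑ j ∈ Finset.range r, α (1 + j) + ∑ j ∈ Finset.range (2 * k), α (1 + r + j) = 0 := by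
      rw [← hsum, add_comm (2 * k) r, Finset.sum_range_add]
      simp only [add_assoc]
    have := aux_prefix_s8 r (2 * k) α (by rw [add_comm r]; exact hanti) hs
    rw [add_comm r 1]
    linarith
  rw [aux_pair] at h1 h2
  have hS1 := hS 1 le_rfl (by omega)
  have hS2 := hS (r + 1) (by omega) le_rfl
  by_contra! hcon
  have key : ∀ m, 1 ≤ m → m ≤ r + 1 → 0 ≤ ∑ i ∈ Finset.range k, α (m + 2 * i) →
      0 < ∑ i ∈ Finset.range k, α (m + 1 + 2 * i) := by
    intro m hm1 hm2 hm3
    have := hcon m hm1 (by omega) (by rw [hconv]; simpa using hm3)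
    rw [hconv] at this
    refine this.trans_eq (Finset.sum_congr rfl fun i _ => ?_)
    congr 1
    omega
  have all : ∀ m, 1 ≤ m → m ≤ r + 2 → 0 ≤ ∑ i ∈ Finset.range k, α (m + 2 * i) := by
    intro m hm
    induction m, hm using Nat.le_induction with
    | base => intro _; linarith
    | succ n hn ih => intro h; exact (key n hn (by omega) (ih (by omega))).le
  have := key (r + 1) (by omega) le_rfl (all _ (by omega) (by omega))
  linarith
end

section
/- Let d and k be integers with 2 ≤ k ≤ d/2, let m be an integer with 1 ≤ m ≤ d−1, and set c = (d−1)·((d−2k)m + d(k−1)) / (k(d−k)(d−2)). Then: (i) c ≥ (d−1)/(d−k); (ii) c ≤ (d−1)/k; (iii) k + c < d; and (iv) k·c ≥ m. -/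
/-- Properties of the proportionality constant
`c = (d−1)((d−2k)m + d(k−1))/(k(d−k)(d−2))` for `2 ≤ k ≤ d/2`, `1 ≤ m ≤ d−1`:
(i) `c ≥ (d−1)/(d−k)`; (ii) `c ≤ (d−1)/k`; (iii) `k + c < d`; (iv) `kc ≥ m`. -/
theorem stmt_11 (d k m : ℕ) (hk2 : 2 ≤ k) (hkd : 2 * k ≤ d)
    (hm1 : 1 ≤ m) (hmd : m ≤ d - 1) (c : ℝ)
    (hc : c = ((d : ℝ) - 1) * (((d : ℝ) - 2 * (k : ℝ)) * (m : ℝ) + (d : ℝ) * ((k : ℝ) - 1))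
        / ((k : ℝ) * ((d : ℝ) - (k : ℝ)) * ((d : ℝ) - 2))) :
    ((d : ℝ) - 1) / ((d : ℝ) - (k : ℝ)) ≤ c
    ∧ c ≤ ((d : ℝ) - 1) / (k : ℝ)
    ∧ (k : ℝ) + c < (d : ℝ)
    ∧ (m : ℝ) ≤ (k : ℝ) * c := by
  have h1 : (2 : ℝ) ≤ k := by exact_mod_cast hk2
  have h2 : 2 * (k : ℝ) ≤ d := by exact_mod_cast hkd
  have h3 : (1 : ℝ) ≤ m := by exact_mod_cast hm1
  have h4 : (m : ℝ) + 1 ≤ d := by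
    have : m + 1 ≤ d := by omega
    exact_mod_cast this
  clear hk2 hkd hm1 hmd
  generalize (d : ℝ) = D at *
  generalize (k : ℝ) = K at *
  generalize (m : ℝ) = M at *
  have hK : 0 < K := by linarith
  have hDK : 0 < D - K := by linarith
  have hD2 : 0 < D - 2 := by linarith
  have hD1 : 0 < D - 1 := by linarith
  have hP : 0 < K * (D - K) * (D - 2) := by positivity
  have e : c * (K * (D - K) * (D - 2)) = (D - 1) * ((D - 2 * K) * M + D * (K - 1)) := by
    rw [hc]; field_simp
  have a1 : 0 ≤ (D - 1) * ((D - 2 * K) * (M - 1)) :=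
    mul_nonneg hD1.le (mul_nonneg (by linarith) (by linarith))
  have a2 : 0 ≤ (D - 1) * ((D - 2 * K) * (D - 1 - M)) :=
    mul_nonneg hD1.le (mul_nonneg (by linarith) (by linarith))
  have a3 : 0 < (K - 1) * (D - K - 1) := mul_pos (by linarith) (by linarith)
  have a4 : 0 ≤ D * (K - 1) * (D - 1 - M) :=
    mul_nonneg (mul_nonneg (by linarith) (by linarith)) (by linarith)
  have ii : c ≤ (D - 1) / K := by
    rw [le_div_iff₀ hK]
    refine le_of_mul_le_mul_right ?_ (mul_pos hDK hD2)
    linarith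
  refine ⟨?_, ii, ?_, ?_⟩
  · rw [div_le_iff₀ hDK]
    refine le_of_mul_le_mul_right ?_ (mul_pos hK hD2)
    linarith
  · have : (D - 1) / K < D - K := by
      rw [div_lt_iff₀ hK]
      linarith
    linarith
  · refine le_of_mul_le_mul_right ?_ (mul_pos hDK hD2)
    linarith
end

section
/- Let d > 2 and let m be an integer with 1 ≤ m ≤ d−1; set z_1 = (d−1)(m−1)/(d−2) and z_d = −(d−1)(d−m−1)/(d−2). Let d = k_1 + ⋯ + k_r be a composition with r ≥ 2 and all k_j ≥ 1, with partial sums K_j = k_1 + ⋯ + k_j, and let b(i) denote the index of the block {K_{j−1}+1,…,K_j} containing i. For β ∈ ℝ^d define h_Q(β) = Σ over ordered pairs (i,j) with b(i) ≤ b(j) of (β_i − β_j)⁺, and φ_Q(β) = z_1·(1/k_1)Σ_{i=1}^{K_1} β_i + z_d·(1/k_r)Σ_{i=K_{r−1}+1}^{d} β_i. Then there exists k ∈ {k_1, d−k_r} ⊆ {K_1,…,K_{r−1}} such that for all β ∈ ℝ^d: h_Q(β) − φ_Q(β) ≤ h_{P_k}(β) − φ_{P_k}(β), where h_{P_k} and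 φ_{P_k} denote the corresponding quantities for the two-block composition (k, d−k); specifically k = k_1 works if k_1 ≤ k_r, and k = d−k_r works if k_1 > k_r. (For any standard parabolic subgroup Q of SL_d there is a maximal parabolic P ⊇ Q with (h−φ_all)([w]_Q) ≤ (h−φ_all)([w]_P) for all Weyl elements w.) -/
/-- `z_1 = (d−1)(m−1)/(d−2)`. -/
noncomputable def zOne (d m : ℕ) : ℝ := ((d : ℝ) - 1) * ((m : ℝ) - 1) / ((d : ℝ) - 2)

/-- `z_d = −(d−1)(d−m−1)/(d−2)`. -/
noncomputable def zD (d m : ℕ) : ℝ :=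
  -(((d : ℝ) - 1) * ((d : ℝ) - (m : ℝ) - 1) / ((d : ℝ) - 2))

/-- Entropy of `diag(β)` on the maximal parabolic `P_kk` (two blocks `kk, d−kk`):
sum of `(β_i − β_j)⁺` over ordered pairs with block index of `i` at most that of `j`. -/
noncomputable def hPmax (d kk : ℕ) (β : ℕ → ℝ) : ℝ :=
  ∑ i ∈ Finset.Icc 1 d, ∑ j ∈ Finset.Icc 1 d,
    if i ≤ kk ∨ kk < j then max (β i - β j) 0 else 0

/-- `φ_all` on the projection of `diag(β)` to `Lie(A_{P_kk})`. -/
noncomputable def phiPmax (d kk m : ℕ) (β : ℕ → ℝ) : ℝ :=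
    zOne d m * ((1 / (kk : ℝ)) * ∑ i ∈ Finset.Icc 1 kk, β i)
  + zD d m * ((1 / ((d : ℝ) - (kk : ℝ))) * ∑ i ∈ Finset.Icc (kk + 1) d, β i)

open Finset in
lemma aux_entropy (d kk : ℕ) (b : ℕ → ℕ) (β : ℕ → ℝ) (A B : Finset ℕ)
    (hA : A ⊆ Finset.Icc 1 d) (hB : B ⊆ Finset.Icc 1 d)
    (h1 : ∀ i ∈ Finset.Icc 1 d, ∀ j ∈ Finset.Icc 1 d, b i ≤ b j → (i ≤ kk ∨ kk < j))
    (h2 : ∀ i ∈ A, ∀ j ∈ B, b j < b i ∧ (i ≤ kk ∨ kk < j)) :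
    (∑ i ∈ Finset.Icc 1 d, ∑ j ∈ Finset.Icc 1 d,
          if b i ≤ b j then max (β i - β j) 0 else 0)
      + ∑ i ∈ A, ∑ j ∈ B, max (β i - β j) 0 ≤ hPmax d kk β := by
  have e : ∑ i ∈ A, ∑ j ∈ B, max (β i - β j) 0 =
      ∑ i ∈ Finset.Icc 1 d, ∑ j ∈ Finset.Icc 1 d,
        if i ∈ A ∧ j ∈ B then max (β i - β j) 0 else 0 := by
    rw [← Finset.sum_subset hA]
    · refine Finset.sum_congr rfl fun i hi => ?_
      rw [← Finset.sum_subset hB]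
      · refine Finset.sum_congr rfl fun j hj => ?_
        simp [hi, hj]
      · intro j _ hj
        simp [hj]
    · intro i _ hi
      simp [hi]
  rw [e, ← Finset.sum_add_distrib]
  unfold hPmax
  refine Finset.sum_le_sum fun i hi => ?_
  rw [← Finset.sum_add_distrib]
  refine Finset.sum_le_sum fun j hj => ?_
  have hn : 0 ≤ max (β i - β j) 0 := le_max_right _ _
  have a1 := h1 i hi j hj
  have a2 := h2 i
  by_cases c1 : b i ≤ b j
  · have : ¬ (i ∈ A ∧ j ∈ B) := fun h => by
      have := (h2 i h.1 j h.2).1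
      omega
    rw [if_pos c1, if_neg this, if_pos (a1 c1)]
    simp
  · by_cases c2 : i ∈ A ∧ j ∈ B
    · rw [if_neg c1, if_pos c2, if_pos (h2 i c2.1 j c2.2).2]
      simp
    · rw [if_neg c1, if_neg c2]
      split_ifs <;> simp

lemma aux_lin (β : ℕ → ℝ) (A B : Finset ℕ) (c : ℝ) (h0 : 0 ≤ c) (h1 : c ≤ 1) :
    c * ((B.card : ℝ) * ∑ i ∈ A, β i - (A.card : ℝ) * ∑ j ∈ B, β j)
      ≤ ∑ i ∈ A, ∑ j ∈ B, max (β i - β j) 0 := by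
  have e : (B.card : ℝ) * ∑ i ∈ A, β i - (A.card : ℝ) * ∑ j ∈ B, β j
      = ∑ i ∈ A, ∑ j ∈ B, (β i - β j) := by
    simp [Finset.sum_sub_distrib, Finset.mul_sum]
  rw [e, Finset.mul_sum]
  refine Finset.sum_le_sum fun i _ => ?_
  rw [Finset.mul_sum]
  refine Finset.sum_le_sum fun j _ => ?_
  have hn : 0 ≤ max (β i - β j) 0 := le_max_right _ _
  have hn' : β i - β j ≤ max (β i - β j) 0 := le_max_left _ _
  nlinarith

lemma aux_prod (d p q : ℕ) (hp : 1 ≤ p) (hpq : p ≤ q) (hd : p + 1 ≤ d) :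
    (d : ℝ) - 1 ≤ ((d : ℝ) - p) * q := by
  have a : (1 : ℝ) ≤ p := by exact_mod_cast hp
  have b : (p : ℝ) ≤ q := by exact_mod_cast hpq
  have c : (p : ℝ) + 1 ≤ d := by exact_mod_cast hd
  nlinarith [mul_nonneg (sub_nonneg.2 b) (by linarith : (0:ℝ) ≤ d - p),
    mul_nonneg (sub_nonneg.2 a) (by linarith : (0:ℝ) ≤ d - p - 1)]

lemma aux_icc_split (f : ℕ → ℝ) (a m n : ℕ) (h : a ≤ m) (h' : m ≤ n) :
    ∑ i ∈ Finset.Icc (a + 1) n, f i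
      = ∑ i ∈ Finset.Icc (a + 1) m, f i + ∑ i ∈ Finset.Icc (m + 1) n, f i := by
  rw [← Finset.sum_union]
  · congr 1
    ext x
    simp only [Finset.mem_union, Finset.mem_Icc]
    omega
  · rw [Finset.disjoint_left]
    intro x
    simp only [Finset.mem_Icc]
    omega

/-- For any standard parabolic `Q` (composition `d = k_1 + ⋯ + k_r`, block index
function `b`) there is a maximal parabolic `P_k ⊇ Q` with
`h_Q(β) − φ_Q(β) ≤ h_{P_k}(β) − φ_{P_k}(β)` for all `β`: namely `k = k_1` works
if `k_1 ≤ k_r`, and `k = d−k_r` works if `k_1 > k_r`. -/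
theorem stmt_12 (d m r : ℕ) (hd : 2 < d) (hm1 : 1 ≤ m) (hmd : m ≤ d - 1)
    (hr : 2 ≤ r) (k : ℕ → ℕ) (hkpos : ∀ j ∈ Finset.Icc 1 r, 1 ≤ k j)
    (hsum : ∑ j ∈ Finset.Icc 1 r, k j = d)
    (b : ℕ → ℕ)
    (hb : ∀ i ∈ Finset.Icc 1 d, 1 ≤ b i ∧ b i ≤ r ∧
      (∑ l ∈ Finset.Icc 1 (b i - 1), k l) < i ∧ i ≤ ∑ l ∈ Finset.Icc 1 (b i), k l) :
    (k 1 ≤ k r → ∀ β : ℕ → ℝ,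
      (∑ i ∈ Finset.Icc 1 d, ∑ j ∈ Finset.Icc 1 d,
          if b i ≤ b j then max (β i - β j) 0 else 0)
        - (zOne d m * ((1 / (k 1 : ℝ)) * ∑ i ∈ Finset.Icc 1 (k 1), β i)
            + zD d m * ((1 / (k r : ℝ))
              * ∑ i ∈ Finset.Icc ((∑ l ∈ Finset.Icc 1 (r - 1), k l) + 1) d, β i))
      ≤ hPmax d (k 1) β - phiPmax d (k 1) m β)
    ∧ (k r < k 1 → ∀ β : ℕ → ℝ,
      (∑ i ∈ Finset.Icc 1 d, ∑ j ∈ Finset.Icc 1 d,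
          if b i ≤ b j then max (β i - β j) 0 else 0)
        - (zOne d m * ((1 / (k 1 : ℝ)) * ∑ i ∈ Finset.Icc 1 (k 1), β i)
            + zD d m * ((1 / (k r : ℝ))
              * ∑ i ∈ Finset.Icc ((∑ l ∈ Finset.Icc 1 (r - 1), k l) + 1) d, β i))
      ≤ hPmax d (d - k r) β - phiPmax d (d - k r) m β) := by
  have hkr : 1 ≤ k r := hkpos r (by simp; omega)
  have hk1 : 1 ≤ k 1 := hkpos 1 (by simp; omega)
  have hmono : ∀ p q : ℕ, p ≤ q → ∑ l ∈ Finset.Icc 1 p, k l ≤ ∑ l ∈ Finset.Icc 1 q, k l :=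
    fun p q hpq => Finset.sum_le_sum_of_subset (Finset.Icc_subset_Icc_right hpq)
  have hS1 : ∑ l ∈ Finset.Icc 1 1, k l = k 1 := by simp
  obtain ⟨s, rfl⟩ : ∃ s, r = s + 1 := ⟨r - 1, by omega⟩
  rw [Finset.sum_Icc_succ_top (by omega)] at hsum
  simp only [Nat.add_sub_cancel]
  have hK := hmono 1 s (by omega)
  rw [hS1] at hK
  generalize hSdef : ∑ l ∈ Finset.Icc 1 s, k l = S at *
  have hfirst : ∀ i ∈ Finset.Icc 1 d, (i ≤ k 1 ↔ b i ≤ 1) := by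
    intro i hi
    obtain ⟨b1, b2, b3, b4⟩ := hb i hi
    constructor
    · intro h
      by_contra hc
      have := hmono 1 (b i - 1) (by omega)
      omega
    · intro h
      have := hmono (b i) 1 h
      omega
  have hlast : ∀ i ∈ Finset.Icc 1 d, (S < i ↔ s < b i) := by
    intro i hi
    obtain ⟨b1, b2, b3, b4⟩ := hb i hi
    constructor
    · intro h
      by_contra hc
      have := hmono (b i) s (by omega)
      omega
    · intro h
      have := hmono s (b i - 1) (by omega)
      omega
  have hbp : ∀ i ∈ Finset.Icc 1 d, 1 ≤ b i ∧ b i ≤ s + 1 := fun i hi => ⟨(hb i hi).1, (hb i hi).2.1⟩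
  generalize hp : k 1 = p at *
  generalize hq : k (s + 1) = q at *
  have hdR : (2 : ℝ) < d := by exact_mod_cast hd
  have hm1R : (1 : ℝ) ≤ m := by exact_mod_cast hm1
  have hmdR : (m : ℝ) + 1 ≤ d := by exact_mod_cast (by omega : m + 1 ≤ d)
  have hpR : (1 : ℝ) ≤ p := by exact_mod_cast hk1
  have hqR : (1 : ℝ) ≤ q := by exact_mod_cast hkr
  have hSR : (S : ℝ) + q = d := by exact_mod_cast hsum
  have hKR : (p : ℝ) ≤ S := by exact_mod_cast hK
  have hz1 : 0 ≤ zOne d m ∧ zOne d m ≤ d - 1 := by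
    unfold zOne
    constructor
    · exact div_nonneg (mul_nonneg (by linarith) (by linarith)) (by linarith)
    · rw [div_le_iff₀ (by linarith)]
      exact mul_le_mul_of_nonneg_left (by linarith) (by linarith)
  have hzd : 0 ≤ -zD d m ∧ -zD d m ≤ d - 1 := by
    unfold zD
    rw [neg_neg]
    constructor
    · exact div_nonneg (mul_nonneg (by linarith) (by linarith)) (by linarith)
    · rw [div_le_iff₀ (by linarith)]
      exact mul_le_mul_of_nonneg_left (by linarith) (by linarith)
  constructor
  · intro hle β
    have E := aux_entropy d p b β (Finset.Icc (S + 1) d) (Finset.Icc (p + 1) S)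
      (Finset.Icc_subset_Icc (by omega) le_rfl) (Finset.Icc_subset_Icc (by omega) (by omega))
      (by
        intro i hi j hj hij
        have := hfirst i hi
        have := hfirst j hj
        omega)
      (by
        intro i hi j hj
        simp only [Finset.mem_Icc] at hi hj
        have hi' : i ∈ Finset.Icc 1 d := by simp only [Finset.mem_Icc]; omega
        have hj' : j ∈ Finset.Icc 1 d := by simp only [Finset.mem_Icc]; omega
        have := hlast i hi'
        have := hlast j hj'
        omega)
    have hprod := aux_prod d p q hk1 hle (by omega)
    have hpos : 0 < ((d : ℝ) - p) * q := mul_pos (by linarith) (by linarith)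
    have Lc := aux_lin β (Finset.Icc (S + 1) d) (Finset.Icc (p + 1) S)
      (-zD d m / (((d : ℝ) - p) * q)) (div_nonneg hzd.1 hpos.le)
      ((div_le_one hpos).2 (hzd.2.trans hprod))
    have c1 : ((Finset.Icc (S + 1) d).card : ℝ) = q := by
      rw [Nat.card_Icc]; congr 1; omega
    have c2 : ((Finset.Icc (p + 1) S).card : ℝ) = d - p - q := by
      rw [Nat.card_Icc, Nat.add_sub_add_right, Nat.cast_sub hK]; linarith
    rw [c1, c2] at Lc
    unfold phiPmax
    rw [aux_icc_split β p S d hK (by omega)]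
    generalize ∑ i ∈ Finset.Icc (p + 1) S, β i = M at *
    generalize ∑ i ∈ Finset.Icc (S + 1) d, β i = L at *
    have hne : (d : ℝ) - p ≠ 0 := by intro h; rw [h] at hpos; simp at hpos
    have hne' : (q : ℝ) ≠ 0 := by positivity
    have id : -zD d m / (((d : ℝ) - p) * q) * (((d : ℝ) - p - q) * L - q * M)
        = zD d m * (1 / ((d : ℝ) - p) * (M + L)) - zD d m * (1 / (q : ℝ) * L) := by
      field_simp
      ring
    linarith
  · intro hlt β
    have hdq : d - q = S := by omega
    rw [hdq]
    have E := aux_entropy d S b β (Finset.Icc (p + 1) S) (Finset.Icc (0 + 1) p)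
      (Finset.Icc_subset_Icc (by omega) (by omega)) (Finset.Icc_subset_Icc (by omega) (by omega))
      (by
        intro i hi j hj hij
        have := hlast i hi
        have := hlast j hj
        omega)
      (by
        intro i hi j hj
        simp only [Finset.mem_Icc] at hi hj
        have hi' : i ∈ Finset.Icc 1 d := by simp only [Finset.mem_Icc]; omega
        have hj' : j ∈ Finset.Icc 1 d := by simp only [Finset.mem_Icc]; omega
        have := hfirst i hi'
        have := hfirst j hj'
        omega)
    have hprod := aux_prod d q p hkr hlt.le (by omega)
    have hS : (d : ℝ) - q = S := by linarith
    rw [hS] at hprod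
    have hpos : 0 < (S : ℝ) * p := mul_pos (by linarith) (by linarith)
    have Lc := aux_lin β (Finset.Icc (p + 1) S) (Finset.Icc (0 + 1) p)
      (zOne d m / ((S : ℝ) * p)) (div_nonneg hz1.1 hpos.le)
      ((div_le_one hpos).2 (hz1.2.trans hprod))
    have c1 : ((Finset.Icc (0 + 1) p).card : ℝ) = p := by
      rw [Nat.card_Icc]; congr 1
    have c2 : ((Finset.Icc (p + 1) S).card : ℝ) = S - p := by
      rw [Nat.card_Icc, Nat.add_sub_add_right, Nat.cast_sub hK]
    rw [c1, c2] at Lc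
    have hq' : (d : ℝ) - S = q := by linarith
    unfold phiPmax
    have sp := aux_icc_split β 0 p S (by omega) hK
    simp only [Nat.zero_add] at sp Lc E
    rw [sp, hq']
    generalize ∑ i ∈ Finset.Icc (p + 1) S, β i = M at *
    generalize ∑ i ∈ Finset.Icc 1 p, β i = F at *
    have hne : (S : ℝ) ≠ 0 := by intro h; rw [h] at hpos; simp at hpos
    have hne' : (p : ℝ) ≠ 0 := by positivity
    have id : zOne d m / ((S : ℝ) * p) * (p * M - ((S : ℝ) - p) * F)
        = zOne d m * (1 / (S : ℝ) * (F + M)) - zOne d m * (1 / (p : ℝ) * F) := by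
      field_simp
      ring
    linarith
end

section
/- Let d > 2 and let α ∈ ℝ^d satisfy α_i ≥ α_{i+1} for all 1 ≤ i ≤ d−1 and Σ_{i=1}^d α_i = 0. Let m be an integer with 1 ≤ m ≤ d−1 and α_m ≥ 0 ≥ α_{m+1}. Then for every integer 1 ≤ k ≤ d−1 and every permutation w of {1,…,d}: h_k(w) − Φ_k(w) ≤ h_G − Σ_{i=1}^d α_i⁺. (This is Proposition 4.5 of the paper, the combinatorial core of Theorem 1.3: the entropy of the entire cusp is at most h(G,a) − Σ_i α_i⁺.) -/
/-- `Φ_k(w) = z_1·(1/k)Σ_{i=1}^k α_{w i} + z_d·(1/(d−k))Σ_{i=k+1}^d α_{w i}`,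
with `z_1 = (d−1)(m−1)/(d−2)`, `z_d = −(d−1)(d−m−1)/(d−2)`. -/
noncomputable def Phik (d k m : ℕ) (α : ℕ → ℝ) (w : ℕ → ℕ) : ℝ :=
    (((d : ℝ) - 1) * ((m : ℝ) - 1) / ((d : ℝ) - 2))
      * ((1 / (k : ℝ)) * ∑ i ∈ Finset.Icc 1 k, α (w i))
  + (-(((d : ℝ) - 1) * ((d : ℝ) - (m : ℝ) - 1) / ((d : ℝ) - 2)))
      * ((1 / ((d : ℝ) - (k : ℝ))) * ∑ i ∈ Finset.Icc (k + 1) d, α (w i))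


/-- The case `m = 1` of the table inequality. -/
lemma table_one (a u v z : ℕ) (hk : 1 ≤ a + v) (hk' : 1 ≤ u + z) (hp : 1 ≤ a + u)
    (hq : 1 ≤ v + z) :
    (0:ℝ) ≤ (u + z) * ((a + u + v + z) * u * v - (v + z))
      + (a + u + v + z - 1) * (a * z - u * v) := by
  rcases u with _ | s
  · obtain ⟨b, rfl⟩ : ∃ b, a = b + 1 := ⟨a - 1, by omega⟩
    have : (0:ℝ) ≤ z * (b * (b + 1 + v + z)) := by positivity
    push_cast
    nlinarith [this]
  rcases v with _ | w
  · obtain ⟨b, rfl⟩ : ∃ b, a = b + 1 := ⟨a - 1, by omega⟩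
    obtain ⟨y, rfl⟩ : ∃ y, z = y + 1 := ⟨z - 1, by omega⟩
    have : (0:ℝ) ≤ (y + 1) * (b * (b + s + y + 3) ) := by positivity
    push_cast
    nlinarith [this]
  rcases z with _ | y
  · have : (0:ℝ) ≤ (s + 1) * (w + 1) * (a + s + w + 2) * s := by positivity
    push_cast
    nlinarith [this]
  · push_cast
    ring_nf
    positivity

/-- The case `m = p` of the table inequality. -/
lemma table_p (a u v z : ℕ) (hk : 1 ≤ a + v) (hk' : 1 ≤ u + z) (hp : 1 ≤ a + u)
    (hq : 1 ≤ v + z) :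
    (0:ℝ) ≤ (a + v) * (u + z) * (a + u + v + z - 2) * ((a + u + v + z - 2) * u * v - a * v - u * z)
      + ((v + z - 1) * (a + v - 1) * (a + v) + (a + u - 1) * (u + z - 1) * (u + z))
        * (a * z - u * v) := by
  rcases u with _ | s
  · obtain ⟨b, rfl⟩ : ∃ b, a = b + 1 := ⟨a - 1, by omega⟩
    obtain ⟨y, rfl⟩ : ∃ y, z = y + 1 := ⟨z - 1, by omega⟩
    push_cast
    ring_nf
    positivity
  rcases v with _ | w
  · obtain ⟨b, rfl⟩ : ∃ b, a = b + 1 := ⟨a - 1, by omega⟩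
    obtain ⟨y, rfl⟩ : ∃ y, z = y + 1 := ⟨z - 1, by omega⟩
    push_cast
    ring_nf
    positivity
  have hE : (((a + (s+1:ℕ) + (w+1:ℕ) + z - 2) * (s+1:ℕ) * (w+1:ℕ) - a * (w+1:ℕ) - (s+1:ℕ) * z) : ℝ)
      = a * (w+1) * s + (s+1) * z * w + (s+1)*(w+1)*(s+w) := by
    push_cast; ring
  rw [hE]
  have hM : (0:ℝ) ≤ (w + z) * (a + w) * (a + w + 1) + (a + s) * (s + z) * (s + z + 1) := by
    positivity
  rcases le_or_gt ((s+1)*(w+1)) (a*z) with h | h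
  · have h' : ((s:ℝ)+1)*(w+1) ≤ a*z := by exact_mod_cast h
    have h1 := mul_nonneg hM (sub_nonneg.2 h')
    have h2 : (0:ℝ) ≤ (a + w + 1) * (s + 1 + z) * (a + s + w + z)
      * (a * (w+1) * s + (s+1) * z * w + (s+1)*(w+1)*(s+w)) := by positivity
    push_cast
    linarith [h1, h2]
  · have key : (0:ℝ) ≤ (a + z + s + w) * (a * (w+1) * s + (s+1) * z * w + (s+1)*(w+1)*(s+w))
        - ((w + z) * (a + w) * (w + 1) + (a + s) * (s + z) * (s + 1)) := by
      have base : (0:ℝ) ≤ a * z * (2 * (s * w) - 2) + 2 * (s+1) * (w+1) * s * w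
          + a * (w+1) * s * (a + s + w) + (s+1) * z * w * (z + s + w) := by
        rcases s with _ | s
        · have h0 : a * z ≤ w := by
            have : a * z < w + 1 := by simpa using h
            omega
          have h0' : (a:ℝ) * z ≤ w := by exact_mod_cast h0
          rcases z with _ | z
          · simp
          have : (0:ℝ) ≤ w * ((z + 1) * (z + 1 + w) - 2) ∨ w = 0 := by
            rcases w with _ | w
            · right; rfl
            · left
              apply mul_nonneg (by positivity)
              push_cast
              ring_nf
              positivity
          rcases this with h1 | rfl
          · push_cast at *
            linarith
          · push_cast at *
            linarith
        rcases w with _ | w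
        · have h0 : a * z ≤ s + 1 := by
            have : a * z < s + 1 + 1 := by simpa using h
            omega
          have h0' : (a:ℝ) * z ≤ s + 1 := by exact_mod_cast h0
          rcases a with _ | a
          · simp
          have h1 : (0:ℝ) ≤ (s + 1) * ((a + 1) * (a + 1 + (s + 1)) - 2) := by
            apply mul_nonneg (by positivity)
            ring_nf
            positivity
          push_cast at *
          linarith
        · push_cast
          ring_nf
          positivity
      have h1 : (0:ℝ) ≤ (w+1)*s*w*(a+z+w) := by positivity
      have h2 : (0:ℝ) ≤ (s+1)*s*w*(a+z+s) := by positivity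
      linarith [base]
    have hd : (0:ℝ) ≤ (a + w + 1) * (s + 1 + z) := by positivity
    have h1 := mul_nonneg hd key
    have h2 : (0:ℝ) ≤ (w + z) * (a + w) * (a + w + 1) * (z * (a + w + 1)) := by positivity
    have h3 : (0:ℝ) ≤ (a + s) * (s + z) * (s + z + 1) * (a * (s + 1 + z)) := by positivity
    push_cast
    linarith [h1, h2, h3]

/-- The case `m ≤ p` of the table inequality, denominators cleared. -/
lemma table_le (a u v z m : ℕ) (hk : 1 ≤ a + v) (hk' : 1 ≤ u + z)
    (hq : 1 ≤ v + z) (hd : 3 ≤ a + u + v + z) (hm : 1 ≤ m) (hmp : m ≤ a + u) :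
    (0:ℝ) ≤ (a + u + v + z - 2) * (a + v) * (u + z) * ((a + u + v + z) * u * v - m * (v + z))
      + (a + u + v + z - 1) * ((m - 1) * (u + z) + (a + u + v + z - m - 1) * (a + v))
        * (a * z - u * v) := by
  have h1 := table_one a u v z hk hk' (by omega) hq
  have hp := table_p a u v z hk hk' (by omega) hq
  have hd' : (3:ℝ) ≤ a + u + v + z := by exact_mod_cast hd
  have hm' : (1:ℝ) ≤ m := by exact_mod_cast hm
  have hmp' : (m:ℝ) ≤ a + u := by exact_mod_cast hmp
  have h1' : (0:ℝ) ≤ (a + u + v + z - 2) * (a + v) := mul_nonneg (by linarith) (by positivity)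
  have h1 := mul_nonneg h1' h1
  rcases eq_or_lt_of_le (hm'.trans hmp') with h | h
  · have : (m:ℝ) = a + u := by linarith
    rw [this]
    linarith
  · have e1 := mul_nonneg (sub_nonneg.2 hmp') h1
    have e2 := mul_nonneg (sub_nonneg.2 hm') hp
    refine nonneg_of_mul_nonneg_right (a := (a + u - 1 : ℝ)) ?_ (by linarith)
    linarith

/-- The table inequality. -/
lemma table (a u v z m : ℕ) (hk : 1 ≤ a + v) (hk' : 1 ≤ u + z) (hp : 1 ≤ a + u)
    (hq : 1 ≤ v + z) (hd : 3 ≤ a + u + v + z) (hm : 1 ≤ m) (hmd : m + 1 ≤ a + u + v + z) :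
    (0:ℝ) ≤ (a + u + v + z - 2) * (a + v) * (u + z) * ((a + u + v + z) * u * v
        - ((a + u + v + z) * (min m (a + u) : ℕ) - m * (a + u)))
      + (a + u + v + z - 1) * ((m - 1) * (u + z) + (a + u + v + z - m - 1) * (a + v))
        * (a * z - u * v) := by
  rcases le_total m (a + u) with h | h
  · rw [min_eq_left h]
    have := table_le a u v z m hk hk' hq hd hm h
    linarith
  · rw [min_eq_right h]
    obtain ⟨n, hn⟩ : ∃ n, a + u + v + z = n + m := ⟨a + u + v + z - m, by omega⟩
    have := table_le z v u a n (by omega) (by omega) (by omega) (by omega) (by omega) (by omega)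
    have hn' : (n:ℝ) = a + u + v + z - m := by
      have : ((a + u + v + z : ℕ) : ℝ) = (n + m : ℕ) := by rw [hn]
      push_cast at this
      linarith
    rw [hn'] at this
    push_cast
    linarith

/-- The table inequality with the coefficient `c`. -/
lemma table_div (a u v z m : ℕ) (d k : ℝ) (hk : 1 ≤ a + v) (hk' : 1 ≤ u + z) (hp : 1 ≤ a + u)
    (hq : 1 ≤ v + z) (hd : 3 ≤ a + u + v + z) (hm : 1 ≤ m) (hmd : m + 1 ≤ a + u + v + z)
    (hdd : d = a + u + v + z) (hkk : k = a + v) :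
    d * (min m (a + u) : ℕ) - m * (a + u : ℕ) ≤ d * (u * v) +
      ((d - 1) * (m - 1) / (d - 2) * (1 / k) + (d - 1) * (d - m - 1) / (d - 2) * (1 / (d - k)))
        * (d * a - k * (a + u : ℕ)) := by
  have h := table a u v z m hk hk' hp hq hd hm hmd
  have hd' : (3:ℝ) ≤ a + u + v + z := by exact_mod_cast hd
  have h1 : (1:ℝ) ≤ a + v := by exact_mod_cast hk
  have h2 : (1:ℝ) ≤ u + z := by exact_mod_cast hk'
  have e1 : d - 2 > 0 := by linarith
  have e2 : k > 0 := by linarith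
  have e3 : d - k > 0 := by linarith
  rw [← sub_nonneg]
  have hpos : 0 < (d - 2) * k * (d - k) := by positivity
  refine nonneg_of_mul_nonneg_right (a := (d - 2) * k * (d - k)) ?_ hpos
  refine h.trans_eq ?_
  have hz : (z:ℝ) = d - k - u := by linarith
  have hv : (v:ℝ) = k - a := by linarith
  rw [hz, hv]
  push_cast
  field_simp
  ring

lemma decomp (α : ℕ → ℝ) (i : ℕ) (hi : 1 ≤ i) (d : ℕ) (hd : i ≤ d) :
    α i = α d + ∑ p ∈ Finset.Ico 1 d, (α p - α (p + 1)) * (if i ≤ p then 1 else 0) := by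
  induction d, hd using Nat.le_induction with
  | base =>
    rw [Finset.sum_eq_zero]
    · simp
    · intro p hp
      have := Finset.mem_Ico.1 hp
      rw [if_neg (by omega), mul_zero]
  | succ n hn ih =>
    rw [Finset.sum_Ico_succ_top (by omega), if_pos hn]
    linarith

lemma sum_decomp {ι : Type*} (s : Finset ι) (f : ι → ℕ) (α : ℕ → ℝ) (d : ℕ)
    (hf : ∀ i ∈ s, 1 ≤ f i ∧ f i ≤ d) :
    ∑ i ∈ s, α (f i) = s.card * α d
      + ∑ p ∈ Finset.Ico 1 d, (α p - α (p + 1)) * ((s.filter (fun i => f i ≤ p)).card : ℝ) := by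
  rw [Finset.sum_congr rfl (fun i hi => decomp α (f i) (hf i hi).1 d (hf i hi).2),
    Finset.sum_add_distrib, Finset.sum_const, nsmul_eq_mul, Finset.sum_comm]
  congr 1
  refine Finset.sum_congr rfl fun p _ => ?_
  rw [← Finset.mul_sum, Finset.sum_boole]

lemma max_decomp (α : ℕ → ℝ) (d i j : ℕ) (hi : 1 ≤ i) (hid : i ≤ d) (hj : 1 ≤ j) (hjd : j ≤ d) :
    ∑ p ∈ Finset.Ico 1 d, (α p - α (p + 1)) * ((if j ≤ p then 1 else 0) * (if ¬ i ≤ p then 1 else 0))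
      ≤ max (α j - α i) 0 := by
  rcases le_total j i with h | h
  · refine le_trans (le_of_eq ?_) (le_max_left _ _)
    rw [decomp α i hi d hid, decomp α j hj d hjd, add_sub_add_left_eq_sub, ← Finset.sum_sub_distrib]
    refine Finset.sum_congr rfl fun p _ => ?_
    by_cases h1 : i ≤ p
    · have : j ≤ p := h.trans h1
      simp [h1, this]
    · simp [h1]
  · refine le_trans (le_of_eq ?_) (le_max_right _ _)
    refine Finset.sum_eq_zero fun p _ => ?_
    by_cases h1 : i ≤ p
    · simp [h1]
    · have : ¬ j ≤ p := by omega
      simp [this]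

/-- Proposition 4.5, the combinatorial core of Theorem 1.3: for every
`1 ≤ k ≤ d−1` and every permutation `w`,
`h_k(w) − Φ_k(w) ≤ h_G − Σ_{i=1}^d α_i⁺`. -/
theorem stmt_13 (d m : ℕ) (hd : 2 < d)
    (α : ℕ → ℝ) (hmono : ∀ i ∈ Finset.Icc 1 (d - 1), α (i + 1) ≤ α i)
    (hsum : ∑ i ∈ Finset.Icc 1 d, α i = 0)
    (hm1 : 1 ≤ m) (hmd : m ≤ d - 1) (hsgn1 : 0 ≤ α m) (hsgn2 : α (m + 1) ≤ 0) :
    ∀ k : ℕ, 1 ≤ k → k ≤ d - 1 →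
      ∀ w : Equiv.Perm ℕ, (∀ i ∈ Finset.Icc 1 d, w i ∈ Finset.Icc 1 d) →
        entk d k α ⇑w - Phik d k m α ⇑w
          ≤ entG d α - ∑ i ∈ Finset.Icc 1 d, max (α i) 0 := by
  intro k hk1 hkd w hw
  set I := Finset.Icc 1 k with hI
  set J := Finset.Icc (k + 1) d with hJ
  have hdisj : Disjoint I J := by
    rw [Finset.disjoint_left]
    intro x hx hy
    simp only [hI, hJ, Finset.mem_Icc] at hx hy
    omega
  have hunion : I ∪ J = Finset.Icc 1 d := by
    ext x
    simp only [hI, hJ, Finset.mem_Icc, Finset.mem_union]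
    omega
  have hIsub : ∀ i ∈ I, 1 ≤ w i ∧ w i ≤ d := fun i hi =>
    Finset.mem_Icc.1 (hw i (hunion ▸ Finset.mem_union_left _ hi))
  have hJsub : ∀ i ∈ J, 1 ≤ w i ∧ w i ≤ d := fun i hi =>
    Finset.mem_Icc.1 (hw i (hunion ▸ Finset.mem_union_right _ hi))
  have himg : (Finset.Icc 1 d).image w = Finset.Icc 1 d := by
    apply Finset.eq_of_subset_of_card_le
    · intro x hx
      obtain ⟨i, hi, rfl⟩ := Finset.mem_image.1 hx
      exact hw i hi
    · rw [Finset.card_image_of_injective _ w.injective]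
  have hre : ∀ f : ℕ → ℝ, ∑ i ∈ Finset.Icc 1 d, f i = ∑ i ∈ I, f (w i) + ∑ i ∈ J, f (w i) := by
    intro f
    rw [← Finset.sum_union hdisj, hunion]
    conv_lhs => rw [← himg]
    rw [Finset.sum_image (fun x _ y _ h => w.injective h)]
  have hG : entG d α = entk d k α w + ∑ i ∈ I, ∑ j ∈ J, max (α (w j) - α (w i)) 0 := by
    unfold entG entk
    rw [hre]
    simp only [hre]
    rw [Finset.sum_add_distrib, Finset.sum_add_distrib, Finset.sum_comm (s := J) (t := I)]
    ring
  have hcI : I.card = k := by simp [hI]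
  have hcJ : J.card = d - k := by simp [hJ]
  -- antitone
  have hanti : ∀ i, 1 ≤ i → ∀ j, i ≤ j → j ≤ d → α j ≤ α i := by
    intro i hi j hij
    induction j, hij using Nat.le_induction with
    | base => intro _; exact le_rfl
    | succ n hn ih =>
      intro h
      exact (hmono n (Finset.mem_Icc.2 ⟨by omega, by omega⟩)).trans (ih (by omega))
  have hP : ∑ i ∈ Finset.Icc 1 d, max (α i) 0 = ∑ i ∈ Finset.Icc 1 m, α i := by
    have hsub : Finset.Icc 1 m ⊆ Finset.Icc 1 d := Finset.Icc_subset_Icc le_rfl (by omega)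
    rw [← Finset.sum_subset hsub (f := fun i => max (α i) 0)]
    · refine Finset.sum_congr rfl fun i hi => ?_
      have := Finset.mem_Icc.1 hi
      exact max_eq_left (hsgn1.trans (hanti i this.1 m this.2 (by omega)))
    · intro i hi hi'
      simp only [Finset.mem_Icc] at hi hi'
      exact max_eq_right ((hanti (m+1) (by omega) i (by omega) hi.2).trans hsgn2)
  have hPd := sum_decomp (Finset.Icc 1 m) id α d (fun i hi => by
    have := Finset.mem_Icc.1 hi
    simp only [id]; omega)
  have hZd := sum_decomp (Finset.Icc 1 d) id α d (fun i hi => by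
    have := Finset.mem_Icc.1 hi
    simp only [id]; omega)
  have hAd := sum_decomp I w α d hIsub
  simp only [id] at hPd hZd
  rw [hsum] at hZd
  rw [hcI] at hAd
  simp only [Nat.card_Icc, Nat.add_sub_cancel] at hPd hZd
  have hAJ : ∑ i ∈ J, α (w i) = - ∑ i ∈ I, α (w i) := by
    have := hre α
    rw [hsum] at this
    linarith
  -- lower bound for the double sum
  have hX : ∑ p ∈ Finset.Ico 1 d, (α p - α (p + 1)) *
      (((J.filter (fun i => w i ≤ p)).card : ℝ) * ((I.filter (fun i => ¬ w i ≤ p)).card : ℝ))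
      ≤ ∑ i ∈ I, ∑ j ∈ J, max (α (w j) - α (w i)) 0 := by
    refine le_trans (le_of_eq ?_) (Finset.sum_le_sum fun i hi => Finset.sum_le_sum fun j hj =>
      max_decomp α d (w i) (w j) (hIsub i hi).1 (hIsub i hi).2 (hJsub j hj).1 (hJsub j hj).2)
    rw [Finset.sum_congr rfl (fun i _ => Finset.sum_comm), Finset.sum_comm]
    refine Finset.sum_congr rfl fun p _ => ?_
    rw [← Finset.sum_boole, ← Finset.sum_boole, mul_comm (∑ i ∈ J, _), Finset.sum_mul_sum,
      Finset.mul_sum]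
    refine Finset.sum_congr rfl fun i _ => ?_
    rw [Finset.mul_sum]
    refine Finset.sum_congr rfl fun j _ => ?_
    ring
  set c : ℝ := ((d:ℝ) - 1) * (m - 1) / (d - 2) * (1 / k)
    + (d - 1) * (d - m - 1) / (d - 2) * (1 / (d - k)) with hc
  have hPhi : Phik d k m α w = c * ∑ i ∈ I, α (w i) := by
    unfold Phik
    rw [hAJ, hc]
    ring
  have hterm : ∀ p ∈ Finset.Ico 1 d, (α p - α (p + 1)) *
      ((d:ℝ) * (((Finset.Icc 1 m).filter (fun i => i ≤ p)).card : ℝ)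
        - m * (((Finset.Icc 1 d).filter (fun i => i ≤ p)).card : ℝ))
      ≤ (α p - α (p + 1)) * (d * (((J.filter (fun i => w i ≤ p)).card : ℝ)
          * ((I.filter (fun i => ¬ w i ≤ p)).card : ℝ))
        + c * (d * ((I.filter (fun i => w i ≤ p)).card : ℝ)
          - k * (((Finset.Icc 1 d).filter (fun i => i ≤ p)).card : ℝ))) := by
    intro p hp
    have hp' := Finset.mem_Ico.1 hp
    refine mul_le_mul_of_nonneg_left ?_ (sub_nonneg.2 (hmono p (Finset.mem_Icc.2 (by omega))))
    have f1 : (Finset.Icc 1 m).filter (fun i => i ≤ p) = Finset.Icc 1 (min m p) := by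
      ext x; simp only [Finset.mem_filter, Finset.mem_Icc]; omega
    have f2 : (Finset.Icc 1 d).filter (fun i => i ≤ p) = Finset.Icc 1 p := by
      ext x; simp only [Finset.mem_filter, Finset.mem_Icc]; omega
    have hau : (I.filter (fun i => w i ≤ p)).card + (J.filter (fun i => w i ≤ p)).card = p := by
      have := hre (fun x => if x ≤ p then 1 else 0)
      simp only [Finset.sum_boole] at this
      rw [f2, Nat.card_Icc, Nat.add_sub_cancel] at this
      exact_mod_cast this.symm
    have hav := Finset.card_filter_add_card_filter_not (s := I) (fun i => w i ≤ p)
    have huz := Finset.card_filter_add_card_filter_not (s := J) (fun i => w i ≤ p)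
    rw [hcI] at hav
    rw [hcJ] at huz
    rw [f1, f2, Nat.card_Icc, Nat.card_Icc, Nat.add_sub_cancel, Nat.add_sub_cancel]
    generalize (I.filter (fun i => w i ≤ p)).card = a at *
    generalize (J.filter (fun i => w i ≤ p)).card = u at *
    generalize (I.filter (fun i => ¬ w i ≤ p)).card = v at *
    generalize (J.filter (fun i => ¬ w i ≤ p)).card = z at *
    have hdd : d = a + u + v + z := by omega
    have := table_div a u v z m d k (by omega) (by omega) (by omega) (by omega) (by omega) hm1
      (by omega) (by exact_mod_cast hdd) (by exact_mod_cast hav.symm)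
    rw [hau] at this
    exact this
  have hfin := Finset.sum_le_sum hterm
  have lin : ∀ (x r f g : ℝ) (F A B U : ℕ → ℝ),
      ∑ p ∈ Finset.Ico 1 d, F p * (x * U p + r * (f * A p - g * B p))
        = x * ∑ p ∈ Finset.Ico 1 d, F p * U p + r * (f * ∑ p ∈ Finset.Ico 1 d, F p * A p
          - g * ∑ p ∈ Finset.Ico 1 d, F p * B p) := by
    intro x r f g F A B U
    simp only [Finset.mul_sum, ← Finset.sum_sub_distrib, ← Finset.sum_add_distrib]
    refine Finset.sum_congr rfl fun p _ => ?_
    ring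
  have lin2 : ∀ (f g : ℝ) (F A B : ℕ → ℝ),
      ∑ p ∈ Finset.Ico 1 d, F p * (f * A p - g * B p)
        = f * ∑ p ∈ Finset.Ico 1 d, F p * A p - g * ∑ p ∈ Finset.Ico 1 d, F p * B p := by
    intro f g F A B
    simp only [Finset.mul_sum, ← Finset.sum_sub_distrib]
    refine Finset.sum_congr rfl fun p _ => ?_
    ring
  rw [lin, lin2] at hfin
  have hdpos : (0:ℝ) < d := by exact_mod_cast (by omega : 0 < d)
  rw [hG, hPhi, hP, hPd, hAd]
  generalize ∑ i ∈ I, ∑ j ∈ J, max (α (w j) - α (w i)) 0 = X at *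
  generalize ∑ p ∈ Finset.Ico 1 d, (α p - α (p + 1)) *
    ((I.filter (fun i => w i ≤ p)).card : ℝ) = SA at *
  generalize ∑ p ∈ Finset.Ico 1 d, (α p - α (p + 1)) *
    (((Finset.Icc 1 m).filter (fun i => i ≤ p)).card : ℝ) = SP at *
  generalize ∑ p ∈ Finset.Ico 1 d, (α p - α (p + 1)) *
    (((Finset.Icc 1 d).filter (fun i => i ≤ p)).card : ℝ) = SZ at *
  have hZ : SZ = - (d * α d) := by linarith
  rw [hZ] at hfin
  have hX' := mul_le_mul_of_nonneg_left hX hdpos.le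
  have : 0 ≤ (d:ℝ) * (X + c * (k * α d + SA) - (m * α d + SP)) := by linarith
  have := nonneg_of_mul_nonneg_right this hdpos
  linarith
end

section
/- Let d and k be integers with 2 ≤ k ≤ d/2, let α ∈ ℝ^d satisfy α_i ≥ α_{i+1} for all 1 ≤ i ≤ d−1 and Σ_{i=1}^d α_i = 0, let m be an integer with 1 ≤ m ≤ d−1 and α_m ≥ 0 ≥ α_{m+1}, and set c = (d−1)·((d−2k)m + d(k−1)) / (k(d−k)(d−2)). If 1 ≤ ⌊c⌋ ≤ k−1, then Σ_{i=1}^{k−⌊c⌋} c·α_i + Σ_{i=1}^{⌊c⌋} [ (⌊c⌋+1−i)·α_{k−⌊c⌋+2i−1} + (c−i)·α_{k−⌊c⌋+2i} ] − Σ_{i=1}^d α_i⁺ ≥ 0. (This is inequality (1) of Proposition 4.7 of the paper.) -/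
theorem aux_main_s14 (d m : ℕ) (hm1 : 1 ≤ m) (hmd : m < d) (α w : ℕ → ℝ)
    (hα : ∀ i j, 1 ≤ i → i ≤ j → j ≤ d → α j ≤ α i)
    (hw : ∀ i j, 1 ≤ i → i ≤ j → j ≤ d → w j ≤ w i)
    (hsum : ∑ i ∈ Finset.Icc 1 d, α i = 0)
    (hsgn1 : 0 ≤ α m) (hsgn2 : α (m + 1) ≤ 0)
    (hW : (m : ℝ) * (d - m) + m * ∑ i ∈ Finset.Icc 1 d, w i ≤ d * ∑ i ∈ Finset.Icc 1 m, w i) :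
    0 ≤ ∑ i ∈ Finset.Icc 1 d, w i * α i - ∑ i ∈ Finset.Icc 1 d, max (α i) 0 := by
  have split : ∀ g : ℕ → ℝ, ∑ i ∈ Finset.Icc 1 d, g i
      = ∑ i ∈ Finset.Icc 1 m, g i + ∑ i ∈ Finset.Icc (m+1) d, g i := by
    intro g
    rw [← Finset.sum_union]
    · congr 1
      ext x; simp only [Finset.mem_Icc, Finset.mem_union]; omega
    · rw [Finset.disjoint_left]
      intro x; simp only [Finset.mem_Icc]; omega
  have cheb : ∀ p q : ℕ, 1 ≤ p → q ≤ d → 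
      (∑ i ∈ Finset.Icc p q, w i) * (∑ i ∈ Finset.Icc p q, α i)
        ≤ ((q + 1 - p : ℕ) : ℝ) * ∑ i ∈ Finset.Icc p q, w i * α i := by
    intro p q hp hq
    have hmv : MonovaryOn w α (Finset.Icc p q) := by
      intro i hi j hj hij
      simp only [Finset.coe_Icc, Set.mem_Icc] at hi hj
      apply hw j i (by omega) _ (by omega)
      by_contra hc
      have := hα i j (by omega) (by omega) (by omega)
      linarith
    have := hmv.sum_mul_sum_le_card_mul_sum
    simpa using this
  have h1 := cheb 1 m le_rfl hmd.le
  have h2 := cheb (m+1) d (by omega) le_rfl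
  have hpos : ∑ i ∈ Finset.Icc 1 d, max (α i) 0 = ∑ i ∈ Finset.Icc 1 m, α i := by
    rw [split, Finset.sum_congr rfl (g := α), Finset.sum_eq_zero (s := Finset.Icc (m+1) d), add_zero]
    · intro i hi
      rw [Finset.mem_Icc] at hi
      exact max_eq_right ((hα (m+1) i (by omega) hi.1 hi.2).trans hsgn2)
    · intro i hi
      rw [Finset.mem_Icc] at hi
      exact max_eq_left (hsgn1.trans (hα i m (by omega) hi.2 (by omega)))
  have hP : 0 ≤ ∑ i ∈ Finset.Icc 1 m, α i := by
    rw [← hpos]; exact Finset.sum_nonneg fun i _ => le_max_right _ _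
  rw [hpos, split]
  rw [split] at hsum
  rw [split w] at hW
  have e1 : ((m + 1 - 1 : ℕ) : ℝ) = m := by simp
  have e2 : ((d + 1 - (m + 1) : ℕ) : ℝ) = d - m := by
    rw [show d + 1 - (m+1) = d - m by omega, Nat.cast_sub hmd.le]
  rw [e1] at h1
  rw [e2] at h2
  generalize (∑ i ∈ Finset.Icc 1 m, α i) = P at *
  have hQ : (∑ i ∈ Finset.Icc (m+1) d, α i) = -P := by linarith
  rw [hQ] at h2
  generalize (∑ i ∈ Finset.Icc 1 m, w i) = A at *
  generalize (∑ i ∈ Finset.Icc (m+1) d, w i) = B at *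
  generalize (∑ i ∈ Finset.Icc 1 m, w i * α i) = X at *
  generalize (∑ i ∈ Finset.Icc (m+1) d, w i * α i) = Y at *
  have hm : (0:ℝ) < m := by exact_mod_cast hm1
  have hd : (0:ℝ) < d - m := by
    have : (m:ℝ) < d := by exact_mod_cast hmd
    linarith
  have k1 := mul_le_mul_of_nonneg_left h1 hd.le
  have k2 := mul_le_mul_of_nonneg_left h2 hm.le
  have k3 := mul_le_mul_of_nonneg_right hW hP
  have : 0 ≤ (m * (d - m)) * (X + Y - P) := by nlinarith
  exact nonneg_of_mul_nonneg_right this (mul_pos hm hd)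

/-- The weight sequence. -/
noncomputable def auxW (a f : ℕ) (c : ℝ) (j : ℕ) : ℝ :=
  if j ≤ a then c else if j ≤ a + 2 * f then
    (if (j - a) % 2 = 1 then (f : ℝ) + 1 - ((j - a + 1) / 2 : ℕ) else c - ((j - a) / 2 : ℕ))
  else 0

theorem auxW_le (a f : ℕ) (c : ℝ) (j : ℕ) (h : j ≤ a) : auxW a f c j = c := by
  simp [auxW, h]

theorem auxW_odd (a f : ℕ) (c : ℝ) (i : ℕ) (h1 : 1 ≤ i) (h : i ≤ f) :
    auxW a f c (a + 2 * i - 1) = (f : ℝ) + 1 - i := by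
  unfold auxW
  rw [if_neg (by omega), if_pos (by omega), if_pos (by omega)]
  rw [show (a + 2 * i - 1 - a + 1) / 2 = i by omega]

theorem auxW_even (a f : ℕ) (c : ℝ) (i : ℕ) (h1 : 1 ≤ i) (h : i ≤ f) :
    auxW a f c (a + 2 * i) = c - i := by
  unfold auxW
  rw [if_neg (by omega), if_pos (by omega), if_neg (by omega)]
  rw [show (a + 2 * i - a) / 2 = i by omega]

theorem auxW_gt (a f : ℕ) (c : ℝ) (j : ℕ) (h : a + 2 * f < j) : auxW a f c j = 0 := by
  unfold auxW
  rw [if_neg (by omega), if_neg (by omega)]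

theorem auxW_anti (a f : ℕ) (c : ℝ) (h1 : (f:ℝ) ≤ c) (h2 : c < f + 1) : Antitone (auxW a f c) := by
  apply antitone_nat_of_succ_le
  intro j
  have hf : (0:ℝ) ≤ f := Nat.cast_nonneg f
  rcases lt_or_ge j a with h | h
  · rw [auxW_le _ _ _ _ h.le, auxW_le _ _ _ _ h]
  rcases lt_or_ge (a + 2 * f) j with h' | h'
  · rw [auxW_gt _ _ _ _ h', auxW_gt _ _ _ _ (by omega)]
  rcases Nat.even_or_odd' (j - a) with ⟨i, hi | hi⟩
  · have hj : j = a + 2 * i := by omega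
    have hL : auxW a f c j = c - i := by
      rcases Nat.eq_zero_or_pos i with h0 | h0
      · rw [auxW_le _ _ _ _ (by omega), h0]; simp
      · rw [hj, auxW_even _ _ _ _ h0 (by omega)]
    rw [hL]
    rcases Nat.lt_or_ge i f with hif | hif
    · rw [show j + 1 = a + 2 * (i+1) - 1 by omega, auxW_odd _ _ _ _ (by omega) (by omega)]
      push_cast; linarith
    · rw [auxW_gt _ _ _ _ (by omega)]
      have : i = f := by omega
      rw [this]; linarith
  · have hj : j = a + 2 * (i+1) - 1 := by omega
    rw [show j + 1 = a + 2 * (i+1) by omega, auxW_even _ _ _ _ (by omega) (by omega), hj,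
      auxW_odd _ _ _ _ (by omega) (by omega)]
    linarith

theorem aux_split_s14 (a : ℕ) (g : ℕ → ℝ) (f : ℕ) : ∑ i ∈ Finset.Icc 1 (a + 2 * f), g i
    = ∑ i ∈ Finset.Icc 1 a, g i + ∑ i ∈ Finset.Icc 1 f, (g (a + 2 * i - 1) + g (a + 2 * i)) := by
  induction f with
  | zero => simp
  | succ n ih =>
    rw [Finset.sum_Icc_succ_top (by omega), ← add_assoc, ← ih,
      show a + 2 * (n+1) = a + 2 * n + 1 + 1 by ring, Finset.sum_Icc_succ_top (by omega),
      Finset.sum_Icc_succ_top (by omega), show a + 2 * n + 1 + 1 - 1 = a + 2 * n + 1 by omega]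
    ring

theorem auxW_sum (a f e : ℕ) (c : ℝ) (g : ℕ → ℝ) (he : a + 2 * f ≤ e) :
    ∑ i ∈ Finset.Icc 1 e, auxW a f c i * g i = ∑ i ∈ Finset.Icc 1 a, c * g i
      + ∑ i ∈ Finset.Icc 1 f, (((f : ℝ) + 1 - (i : ℝ)) * g (a + 2 * i - 1)
            + (c - (i : ℝ)) * g (a + 2 * i)) := by
  rw [← Finset.sum_subset (s₁ := Finset.Icc 1 (a + 2 * f))]
  · rw [aux_split_s14]
    congr 1
    · refine Finset.sum_congr rfl fun i hi => ?_
      rw [Finset.mem_Icc] at hi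
      rw [auxW_le _ _ _ _ hi.2]
    · refine Finset.sum_congr rfl fun i hi => ?_
      rw [Finset.mem_Icc] at hi
      rw [auxW_odd _ _ _ _ hi.1 hi.2, auxW_even _ _ _ _ hi.1 hi.2]
  · exact Finset.Icc_subset_Icc le_rfl he
  · intro x hx hx'
    rw [Finset.mem_Icc] at hx hx'
    rw [auxW_gt _ _ _ _ (by omega), zero_mul]

theorem aux_arith (x : ℝ) (n : ℕ) : ∑ i ∈ Finset.Icc 1 n, (x - 2 * (i:ℝ)) = n * x - n * (n + 1) := by
  induction n with
  | zero => simp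
  | succ n ih => rw [Finset.sum_Icc_succ_top (by omega), ih]; push_cast; ring

theorem auxW_total (a f e : ℕ) (c : ℝ) (he : a + 2 * f ≤ e) :
    ∑ i ∈ Finset.Icc 1 e, auxW a f c i = c * (a + f) := by
  have h := auxW_sum a f e c (fun _ => 1) he
  simp only [mul_one] at h
  have h2 : ∑ i ∈ Finset.Icc 1 f, (((f : ℝ) + 1 - (i : ℝ)) + (c - (i : ℝ)))
     = ∑ i ∈ Finset.Icc 1 f, ((f + 1 + c) - 2 * (i:ℝ)) :=
    Finset.sum_congr rfl fun i _ => by ring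
  rw [h, h2, aux_arith]
  simp
  ring

theorem auxW_init (a f e : ℕ) (c : ℝ) (he : e ≤ a) :
    ∑ i ∈ Finset.Icc 1 e, auxW a f c i = c * e := by
  rw [Finset.sum_congr rfl (g := fun _ => c)]
  · simp; ring
  · intro i hi
    rw [Finset.mem_Icc] at hi
    exact auxW_le _ _ _ _ (by omega)

theorem aux_cases (d k m f : ℕ) (c : ℝ) (hk2 : 2 ≤ k) (hkd : 2 * k ≤ d)
    (hc : c * ((k : ℝ) * ((d : ℝ) - k) * ((d : ℝ) - 2)) =
      ((d : ℝ) - 1) * (((d : ℝ) - 2 * (k : ℝ)) * (m : ℝ) + (d : ℝ) * ((k : ℝ) - 1)))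
    (h1 : (f:ℝ) ≤ c) (hf1 : 1 ≤ f) (hfk : f ≤ k - 1)
    (hm1 : k - f < m) (hm2 : m < k + f) : (f = 1 ∧ m = k) ∨ (f = 2 ∧ m = k + 1) := by
  have hk : (2:ℝ) ≤ k := by exact_mod_cast hk2
  have hd : 2 * (k:ℝ) ≤ d := by exact_mod_cast hkd
  have key : 0 < ((d:ℝ) - k)^2 + k^2 - d := by nlinarith
  have hD : 0 < ((d : ℝ) - k) * ((d : ℝ) - 2) := mul_pos (by linarith) (by linarith)
  rcases lt_or_ge m k with hmk | hmk
  · have hmk' : (m:ℝ) ≤ k := by exact_mod_cast hmk.le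
    have : c < 2 := by
      by_contra hcc
      have hcc : 2 ≤ c := not_lt.mp hcc
      have e1 := mul_le_mul_of_nonneg_right hcc (mul_pos (by linarith : (0:ℝ) < k) hD).le
      have e2 : 0 ≤ ((d:ℝ) - 1) * (d - 2 * k) * (k - m) :=
        mul_nonneg (mul_nonneg (by linarith) (by linarith)) (by linarith)
      nlinarith
    have hf2 : f < 2 := by
      have : (f:ℝ) < 2 := by linarith
      exact_mod_cast this
    omega
  · have hmk' : (k:ℝ) ≤ m := by exact_mod_cast hmk
    have h3 : c * k < m + k := by
      by_contra hcc
      have hcc := not_lt.mp hcc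
      have e1 := mul_le_mul_of_nonneg_right hcc hD.le
      have e2 : 0 ≤ (d:ℝ) * (k - 1) * (m - k) :=
        mul_nonneg (mul_nonneg (by linarith) (by linarith)) (by linarith)
      nlinarith
    have h4 : f * k < m + k := by
      have : (f:ℝ) * k < m + k := by nlinarith
      exact_mod_cast this
    have h5 : f < 3 := by
      by_contra h
      obtain ⟨t, rfl⟩ : ∃ t, f = t + 3 := ⟨f - 3, by omega⟩
      nlinarith
    interval_cases f <;> omega

theorem stmt_14 (d k m : ℕ) (hk2 : 2 ≤ k) (hkd : 2 * k ≤ d)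
    (α : ℕ → ℝ) (hmono : ∀ i ∈ Finset.Icc 1 (d - 1), α (i + 1) ≤ α i)
    (hsum : ∑ i ∈ Finset.Icc 1 d, α i = 0)
    (hm1 : 1 ≤ m) (hmd : m ≤ d - 1) (hsgn1 : 0 ≤ α m) (hsgn2 : α (m + 1) ≤ 0)
    (c : ℝ)
    (hc : c = ((d : ℝ) - 1) * (((d : ℝ) - 2 * (k : ℝ)) * (m : ℝ) + (d : ℝ) * ((k : ℝ) - 1))
        / ((k : ℝ) * ((d : ℝ) - (k : ℝ)) * ((d : ℝ) - 2)))
    (hfl1 : 1 ≤ ⌊c⌋₊) (hfl2 : ⌊c⌋₊ ≤ k - 1) :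
    0 ≤ (∑ i ∈ Finset.Icc 1 (k - ⌊c⌋₊), c * α i)
      + (∑ i ∈ Finset.Icc 1 ⌊c⌋₊,
          (((⌊c⌋₊ : ℝ) + 1 - (i : ℝ)) * α (k - ⌊c⌋₊ + 2 * i - 1)
            + (c - (i : ℝ)) * α (k - ⌊c⌋₊ + 2 * i)))
      - ∑ i ∈ Finset.Icc 1 d, max (α i) 0 := by
  have hk : (2:ℝ) ≤ k := by exact_mod_cast hk2
  have hd : 2 * (k:ℝ) ≤ d := by exact_mod_cast hkd
  have hD : 0 < ((d : ℝ) - k) * ((d : ℝ) - 2) := mul_pos (by linarith) (by linarith)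
  have hc' : c * ((k : ℝ) * ((d : ℝ) - k) * ((d : ℝ) - 2)) =
      ((d : ℝ) - 1) * (((d : ℝ) - 2 * (k : ℝ)) * (m : ℝ) + (d : ℝ) * ((k : ℝ) - 1)) := by
    have : (k : ℝ) * ((d : ℝ) - k) * ((d : ℝ) - 2) ≠ 0 := by
      rw [mul_assoc]; exact (mul_pos (by linarith) hD).ne'
    rw [hc]; exact div_mul_cancel₀ _ this
  have hc0 : 0 ≤ c := by
    by_contra h
    rw [Nat.floor_of_nonpos (by linarith)] at hfl1
    omega
  have hf1 : (⌊c⌋₊ : ℝ) ≤ c := Nat.floor_le hc0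
  have hf2 : c < ⌊c⌋₊ + 1 := Nat.lt_floor_add_one c
  clear hc
  generalize ⌊c⌋₊ = f at *
  have hm1' : (1:ℝ) ≤ m := by exact_mod_cast hm1
  have hmd' : (m:ℝ) + 1 ≤ d := by exact_mod_cast (by omega : m + 1 ≤ d)
  have hc1 : 1 ≤ c := le_trans (by exact_mod_cast hfl1) hf1
  have hcast : ((k - f : ℕ) : ℝ) = k - f := Nat.cast_sub (by omega)
  rw [← auxW_sum (k - f) f d c α (by omega)]
  apply aux_main_s14 d m hm1 (by omega) α _ _ _ hsum hsgn1 hsgn2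
  · rw [auxW_total _ _ _ _ (by omega), hcast]
    rcases Nat.lt_or_ge (k - f) m with h | h
    · rcases Nat.lt_or_ge m (k + f) with h' | h'
      · rcases aux_cases d k m f c hk2 hkd hc' hf1 hfl1 hfl2 h h' with ⟨rfl, rfl⟩ | ⟨rfl, rfl⟩
        · obtain ⟨a, rfl⟩ : ∃ a, m = a + 1 := ⟨m - 1, by omega⟩
          have ho := auxW_odd a 1 c 1 le_rfl le_rfl
          rw [show a + 2 * 1 - 1 = a + 1 by omega] at ho
          rw [show a + 1 - 1 = a by omega, Finset.sum_Icc_succ_top (by omega),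
            auxW_init _ _ _ _ le_rfl, ho]
          push_cast at *
          nlinarith [mul_nonneg (sub_nonneg.2 hc1) (show (0:ℝ) ≤ d * a - (a+1)^2 by nlinarith)]
        · obtain ⟨a, rfl⟩ : ∃ a, k = a + 2 := ⟨k - 2, by omega⟩
          have ha : (1:ℝ) ≤ a := by exact_mod_cast (by omega : 1 ≤ a)
          have ho := auxW_odd a 2 c 1 le_rfl (by omega)
          have he := auxW_even a 2 c 1 le_rfl (by omega)
          have ho2 := auxW_odd a 2 c 2 (by omega) (by omega)
          rw [show a + 2 * 1 - 1 = a + 1 by omega] at ho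
          rw [show a + 2 * 1 = a + 1 + 1 by omega] at he
          rw [show a + 2 * 2 - 1 = a + 1 + 1 + 1 by omega] at ho2
          rw [show a + 2 - 2 = a by omega, show a + 2 + 1 = a + 1 + 1 + 1 by omega,
            Finset.sum_Icc_succ_top (by omega), Finset.sum_Icc_succ_top (by omega),
            Finset.sum_Icc_succ_top (by omega),
            auxW_init _ _ _ _ le_rfl, ho, he, ho2]
          push_cast at *
          nlinarith [mul_nonneg (sub_nonneg.2 hc1)
            (show (0:ℝ) ≤ d * (a + 1) - (a+2) * (a + 3) by nlinarith)]
      · rw [auxW_total _ _ _ _ (by omega), hcast]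
        have h0 : m ≤ c * k := by
          by_contra hcc
          have hcc := not_le.mp hcc
          have e1 := mul_lt_mul_of_pos_right hcc hD
          have e2 : 0 ≤ (d:ℝ) * (k - 1) * (d - 1 - m) :=
            mul_nonneg (mul_nonneg (by linarith) (by linarith)) (by linarith)
          nlinarith
        nlinarith [mul_nonneg (sub_nonneg.2 h0) (show (0:ℝ) ≤ d - m by linarith)]
    · rw [auxW_init _ _ _ _ h]
      have h0 : (d:ℝ) - m ≤ c * (d - k) := by
        by_contra hcc
        have hcc := not_le.mp hcc
        have e1 := mul_lt_mul_of_pos_right hcc (show (0:ℝ) < k * (d - 2) from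
          mul_pos (by linarith) (by linarith))
        have e2 : 0 ≤ ((d:ℝ) - 1) * (d - 2 * k) * (m - 1) :=
            mul_nonneg (mul_nonneg (by linarith) (by linarith)) (by linarith)
        have e3 : 0 ≤ (k:ℝ) * (d - 2) * (m - 1) :=
            mul_nonneg (mul_nonneg (by linarith) (by linarith)) (by linarith)
        nlinarith
      nlinarith [mul_nonneg (sub_nonneg.2 h0) (show (0:ℝ) ≤ m by linarith)]
  · intro i j hi hij hj
    induction j, hij using Nat.le_induction with
    | base => exact le_rfl
    | succ n hn ih =>
      exact (hmono n (Finset.mem_Icc.2 ⟨by omega, by omega⟩)).trans (ih (by omega))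
  · intro i j _ hij _
    exact auxW_anti _ _ _ hf1 hf2 hij
end

section
/- Let d and k be integers with 2 ≤ k ≤ d/2, let α ∈ ℝ^d satisfy α_i ≥ α_{i+1} for all 1 ≤ i ≤ d−1 and Σ_{i=1}^d α_i = 0, let m be an integer with 1 ≤ m ≤ d−1 and α_m ≥ 0 ≥ α_{m+1}, and set c = (d−1)·((d−2k)m + d(k−1)) / (k(d−k)(d−2)). If k ≤ ⌊c⌋ ≤ d−k−1, then Σ_{i=1}^{⌊c⌋−k+1} k·α_i + Σ_{i=1}^{k−1} (k−i)·α_{⌊c⌋−k+1+2i} + Σ_{i=1}^{k} (k + {c} − i)·α_{⌊c⌋−k+2i} − Σ_{i=1}^d α_i⁺ ≥ 0, where {c} = c − ⌊c⌋. (This is inequality (2) of Proposition 4.7 of the paper.) -/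
lemma aux_prefix_s15 (α : ℕ → ℝ) (a k : ℕ) :
    (∑ i ∈ Finset.Icc 1 (a + 1), α i) + (∑ i ∈ Finset.Icc 1 k, α (a + 1 + 2 * i))
      + (∑ i ∈ Finset.Icc 1 k, α (a + 2 * i)) = ∑ i ∈ Finset.Icc 1 (a + 1 + 2 * k), α i := by
  induction k with
  | zero => simp
  | succ k ih =>
    rw [Finset.sum_Icc_succ_top (b := k) (by omega), Finset.sum_Icc_succ_top (b := k) (by omega),
      show a + 1 + 2 * (k + 1) = (a + 1 + 2 * k + 1) + 1 by ring,
      Finset.sum_Icc_succ_top (b := a + 1 + 2 * k + 1) (by omega),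
      Finset.sum_Icc_succ_top (b := a + 1 + 2 * k) (by omega), ← ih,
      show a + 2 * (k + 1) = a + 1 + 2 * k + 1 by ring]
    ring

lemma aux_layers (α : ℕ → ℝ) (f : ℝ) (a k : ℕ) :
    (∑ i ∈ Finset.Icc 1 (a + 1), (k : ℝ) * α i)
      + (∑ i ∈ Finset.Icc 1 k, ((k : ℝ) - (i : ℝ)) * α (a + 1 + 2 * i))
      + (∑ i ∈ Finset.Icc 1 k, ((k : ℝ) + f - (i : ℝ)) * α (a + 2 * i))
    = ∑ l ∈ Finset.range k, ((1 - f) * (∑ i ∈ Finset.Icc 1 (a + 1 + 2 * l), α i)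
        + f * (∑ i ∈ Finset.Icc 1 (a + 2 + 2 * l), α i)) := by
  induction k with
  | zero => simp
  | succ k ih =>
    rw [Finset.sum_range_succ, ← ih,
      show a + 2 + 2 * k = (a + 1 + 2 * k) + 1 by ring,
      Finset.sum_Icc_succ_top (b := a + 1 + 2 * k) (by omega), ← aux_prefix_s15,
      Finset.sum_Icc_succ_top (b := k) (by omega), Finset.sum_Icc_succ_top (b := k) (by omega),
      show a + 2 * (k + 1) = a + 1 + 2 * k + 1 by ring]
    have h1 : ∑ i ∈ Finset.Icc 1 (a + 1), ((k + 1 : ℕ) : ℝ) * α i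
        = ∑ i ∈ Finset.Icc 1 (a + 1), (k : ℝ) * α i + ∑ i ∈ Finset.Icc 1 (a + 1), α i := by
      rw [← Finset.sum_add_distrib]
      exact Finset.sum_congr rfl fun i _ => by push_cast; ring
    have h2 : ∑ i ∈ Finset.Icc 1 k, (((k + 1 : ℕ) : ℝ) - (i : ℝ)) * α (a + 1 + 2 * i)
        = ∑ i ∈ Finset.Icc 1 k, ((k : ℝ) - (i : ℝ)) * α (a + 1 + 2 * i)
          + ∑ i ∈ Finset.Icc 1 k, α (a + 1 + 2 * i) := by
      rw [← Finset.sum_add_distrib]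
      exact Finset.sum_congr rfl fun i _ => by push_cast; ring
    have h3 : ∑ i ∈ Finset.Icc 1 k, (((k + 1 : ℕ) : ℝ) + f - (i : ℝ)) * α (a + 2 * i)
        = ∑ i ∈ Finset.Icc 1 k, ((k : ℝ) + f - (i : ℝ)) * α (a + 2 * i)
          + ∑ i ∈ Finset.Icc 1 k, α (a + 2 * i) := by
      rw [← Finset.sum_add_distrib]
      exact Finset.sum_congr rfl fun i _ => by push_cast; ring
    rw [h1, h2, h3]
    push_cast
    ring

lemma aux_sumidx (a k : ℕ) (f : ℝ) :
    ∑ l ∈ Finset.range k, ((1 - f) * ((a + 1 + 2 * l : ℕ) : ℝ) + f * ((a + 2 + 2 * l : ℕ) : ℝ))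
      = k * (a + k + f) := by
  induction k with
  | zero => simp
  | succ k ih =>
    rw [Finset.sum_range_succ, ih]
    push_cast
    ring

lemma aux_real (D K M X : ℝ) (hD : 2 * K + 1 ≤ D) (hM1 : 1 ≤ M)
    (hK : 3 ≤ K ∨ (K = 2 ∧ (M ≤ 2 ∨ 3 ≤ M))) (hK2 : 2 ≤ K)
    (H : K * X * ((D - K) * (D - 2)) = (D - 1) * ((D - 2 * K) * M + D * (K - 1)))
    (hX1 : K ≤ X) (hX2 : M + 1 - K ≤ X) : False := by
  have hp : 0 < (D - K) * (D - 2) := mul_pos (by linarith) (by linarith)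
  have H2 : (K * X - M) * ((D - K) * (D - 2)) = D * (K - 1) * (D - 1 - M) := by linarith
  have h1 : (K - 1) * (K - 1) ≤ K * X - M := by nlinarith
  have h2 : (K - 1) * (K - 1) * ((D - K) * (D - 2)) ≤ D * (K - 1) * (D - 1 - M) := by
    rw [← H2]; exact mul_le_mul_of_nonneg_right h1 hp.le
  have h3 : (K - 1) * ((D - K) * (D - 2)) ≤ D * (D - 1 - M) := by
    have : (K - 1) * ((K - 1) * ((D - K) * (D - 2))) ≤ (K - 1) * (D * (D - 1 - M)) := by
      linarith
    exact le_of_mul_le_mul_left this (by linarith)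
  rcases hK with hK | ⟨hK, hM | hM⟩
  · have h4 : D * (D - 1 - M) ≤ D * (D - 2) :=
      mul_le_mul_of_nonneg_left (by linarith) (by linarith)
    have h5 : (K - 1) * (D - K) ≤ D := by
      have : (K - 1) * (D - K) * (D - 2) ≤ D * (D - 2) := by linarith
      exact le_of_mul_le_mul_right this (by linarith)
    nlinarith
  · subst hK
    have h6 : 2 * 2 * ((D - 2) * (D - 2)) ≤ 2 * X * ((D - 2) * (D - 2)) :=
      mul_le_mul_of_nonneg_right (by linarith) hp.le
    have h7 : (D - 1) * ((D - 2 * 2) * M + D * (2 - 1)) ≤ (D - 1) * ((D - 2 * 2) * 2 + D * (2 - 1)) := by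
      apply mul_le_mul_of_nonneg_left _ (by linarith)
      nlinarith
    nlinarith
  · subst hK
    nlinarith


/-- Inequality (2) of Proposition 4.7: if `k ≤ ⌊c⌋ ≤ d−k−1`, then
`Σ_{i=1}^{⌊c⌋−k+1} k·α_i + Σ_{i=1}^{k−1} (k−i)·α_{⌊c⌋−k+1+2i}
  + Σ_{i=1}^{k} (k+{c}−i)·α_{⌊c⌋−k+2i} − Σ_{i=1}^d α_i⁺ ≥ 0`,
where `{c} = c − ⌊c⌋`. -/
theorem stmt_15 (d k m : ℕ) (hk2 : 2 ≤ k) (hkd : 2 * k ≤ d)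
    (α : ℕ → ℝ) (hmono : ∀ i ∈ Finset.Icc 1 (d - 1), α (i + 1) ≤ α i)
    (hsum : ∑ i ∈ Finset.Icc 1 d, α i = 0)
    (hm1 : 1 ≤ m) (hmd : m ≤ d - 1) (hsgn1 : 0 ≤ α m) (hsgn2 : α (m + 1) ≤ 0)
    (c : ℝ)
    (hc : c = ((d : ℝ) - 1) * (((d : ℝ) - 2 * (k : ℝ)) * (m : ℝ) + (d : ℝ) * ((k : ℝ) - 1))
        / ((k : ℝ) * ((d : ℝ) - (k : ℝ)) * ((d : ℝ) - 2)))
    (hfl1 : k ≤ ⌊c⌋₊) (hfl2 : ⌊c⌋₊ ≤ d - k - 1) :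
    0 ≤ (∑ i ∈ Finset.Icc 1 (⌊c⌋₊ - k + 1), (k : ℝ) * α i)
      + (∑ i ∈ Finset.Icc 1 (k - 1), ((k : ℝ) - (i : ℝ)) * α (⌊c⌋₊ - k + 1 + 2 * i))
      + (∑ i ∈ Finset.Icc 1 k,
          ((k : ℝ) + (c - (⌊c⌋₊ : ℝ)) - (i : ℝ)) * α (⌊c⌋₊ - k + 2 * i))
      - ∑ i ∈ Finset.Icc 1 d, max (α i) 0 := by
  set n := ⌊c⌋₊ with hn
  have hd5 : 2 * k + 1 ≤ d := by omega
  have hK2 : (2 : ℝ) ≤ k := by exact_mod_cast hk2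
  have hD : 2 * (k : ℝ) + 1 ≤ d := by exact_mod_cast hd5
  have hM1 : (1 : ℝ) ≤ m := by exact_mod_cast hm1
  have hMD : (m : ℝ) ≤ d - 1 := by
    have : m + 1 ≤ d := by omega
    have : (m : ℝ) + 1 ≤ d := by exact_mod_cast this
    linarith
  have hpos : 0 < ((d : ℝ) - k) * (d - 2) := mul_pos (by linarith) (by linarith)
  have H : (k : ℝ) * c * (((d : ℝ) - k) * (d - 2))
      = ((d : ℝ) - 1) * (((d : ℝ) - 2 * k) * m + d * ((k : ℝ) - 1)) := by
    have h1 : (d : ℝ) - k ≠ 0 := by linarith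
    have h2 : (d : ℝ) - 2 ≠ 0 := by linarith
    have h3 : (k : ℝ) ≠ 0 := by linarith
    rw [hc]
    field_simp
  have hnpos : 0 < n := by omega
  have hcn : (n : ℝ) ≤ c := Nat.floor_le (by
    by_contra hneg
    have := Nat.floor_of_nonpos (not_le.mp hneg).le
    omega)
  have hcn1 : c < n + 1 := Nat.lt_floor_add_one c
  have hkn : (k : ℝ) ≤ n := by exact_mod_cast hfl1
  have hmn : n + k ≤ m := by
    by_contra hlt
    have h1 : m + 1 ≤ n + k := by omega
    have h2 : (m : ℝ) + 1 ≤ n + k := by exact_mod_cast h1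
    refine aux_real d k m c hD hM1 ?_ hK2 H (by linarith) (by linarith)
    rcases Nat.lt_or_ge k 3 with h | h
    · right
      refine ⟨?_, ?_⟩
      · have : k = 2 := by omega
        exact_mod_cast this
      · rcases Nat.lt_or_ge m 3 with h' | h'
        · left
          have : m ≤ 2 := by omega
          exact_mod_cast this
        · right
          exact_mod_cast h'
    · left
      exact_mod_cast h
  have hkc : (m : ℝ) ≤ k * c := by
    have h1 : (m : ℝ) * (((d : ℝ) - k) * (d - 2)) ≤ k * c * (((d : ℝ) - k) * (d - 2)) := by
      have : 0 ≤ (d : ℝ) * ((k : ℝ) - 1) * (d - 1 - m) :=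
        mul_nonneg (mul_nonneg (by linarith) (by linarith)) (by linarith)
      linarith
    exact le_of_mul_le_mul_right h1 hpos
  have hanti : ∀ i j, 1 ≤ i → i ≤ j → j ≤ d → α j ≤ α i := by
    intro i j hi hij
    induction j, hij using Nat.le_induction with
    | base => intro _; exact le_rfl
    | succ j hij ih =>
      intro hj
      exact (hmono j (Finset.mem_Icc.mpr ⟨by omega, by omega⟩)).trans (ih (by omega))
  set P : ℕ → ℝ := fun j => ∑ i ∈ Finset.Icc 1 j, α i with hP
  have hPlow : ∀ j, 1 ≤ j → j ≤ d → (j : ℝ) * α j ≤ P j := by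
    intro j hj hjd
    have := Finset.card_nsmul_le_sum (Finset.Icc 1 j) α (α j) (by
      intro i hi
      rw [Finset.mem_Icc] at hi
      exact hanti i j hi.1 hi.2 hjd)
    simpa using this
  have hPup : ∀ j m', 1 ≤ j → j ≤ m' → m' ≤ d → P m' ≤ P j + ((m' : ℝ) - j) * α j := by
    intro j m' hj hjm
    induction m', hjm using Nat.le_induction with
    | base => intro _; simp
    | succ q hq ih =>
      intro hqd
      have h1 := ih (by omega)
      have h2 : P (q + 1) = P q + α (q + 1) := Finset.sum_Icc_succ_top (by omega) _
      have h3 := hanti j (q + 1) hj (by omega) hqd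
      rw [h2]
      push_cast
      linarith
  have hPm : ∀ j, 1 ≤ j → j ≤ m → (j : ℝ) * P m ≤ m * P j := by
    intro j hj hjm
    have h1 := hPup j m hj hjm (by omega)
    have h2 := hPlow j hj (by omega)
    have h3 : (j : ℝ) ≤ m := by exact_mod_cast hjm
    have h4 : (0 : ℝ) ≤ j := Nat.cast_nonneg j
    nlinarith [mul_le_mul_of_nonneg_left h1 h4,
      mul_le_mul_of_nonneg_left h2 (sub_nonneg.mpr h3)]
  have hPm0 : 0 ≤ P m := (mul_nonneg (by linarith) hsgn1).trans (hPlow m hm1 (by omega))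
  have hmax : ∑ i ∈ Finset.Icc 1 d, max (α i) 0 = P m := by
    rw [hP]
    symm
    apply Finset.sum_subset_zero_on_sdiff
    · exact Finset.Icc_subset_Icc le_rfl (by omega)
    · intro i hi
      simp only [Finset.mem_sdiff, Finset.mem_Icc] at hi
      exact max_eq_right ((hanti (m + 1) i (by omega) (by omega) (by omega)).trans hsgn2)
    · intro i hi
      rw [Finset.mem_Icc] at hi
      exact (max_eq_left (hsgn1.trans (hanti i m hi.1 hi.2 (by omega)))).symm
  obtain ⟨a, ha⟩ : ∃ a, n = a + k := ⟨n - k, by omega⟩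
  have hak : n - k = a := by omega
  have hext : ∑ i ∈ Finset.Icc 1 (k - 1), ((k : ℝ) - (i : ℝ)) * α (a + 1 + 2 * i)
      = ∑ i ∈ Finset.Icc 1 k, ((k : ℝ) - (i : ℝ)) * α (a + 1 + 2 * i) := by
    obtain ⟨q, rfl⟩ : ∃ q, k = q + 1 := ⟨k - 1, by omega⟩
    rw [Finset.sum_Icc_succ_top (by omega)]
    simp
  rw [hak, hext, aux_layers, hmax, sub_nonneg]
  have hsumle : ∑ l ∈ Finset.range k, ((1 - (c - n)) * ((a + 1 + 2 * l : ℕ) : ℝ)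
        + (c - n) * ((a + 2 + 2 * l : ℕ) : ℝ)) * P m
      ≤ ∑ l ∈ Finset.range k, m * ((1 - (c - n)) * P (a + 1 + 2 * l)
        + (c - n) * P (a + 2 + 2 * l)) := by
    apply Finset.sum_le_sum
    intro l hl
    rw [Finset.mem_range] at hl
    have h1 := mul_le_mul_of_nonneg_left (hPm (a + 1 + 2 * l) (by omega) (by omega))
      (show 0 ≤ 1 - (c - n) by linarith)
    have h2 := mul_le_mul_of_nonneg_left (hPm (a + 2 + 2 * l) (by omega) (by omega))
      (show 0 ≤ c - n by linarith)
    linarith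
  rw [← Finset.sum_mul, aux_sumidx, ← Finset.mul_sum] at hsumle
  have hac : (a : ℝ) + k + (c - n) = c := by
    rw [ha]; push_cast; ring
  rw [hac] at hsumle
  have hfin := (mul_le_mul_of_nonneg_right hkc hPm0).trans hsumle
  exact le_of_mul_le_mul_left hfin (by linarith)
end

section
/- Let d ≥ 2, let α ∈ ℝ^d satisfy α_i ≥ α_{i+1} for all 1 ≤ i ≤ d−1 and Σ_{i=1}^d α_i = 0, and let m be an integer with 1 ≤ m ≤ d−1 and α_m ≥ 0 ≥ α_{m+1}. Let 1 ≤ n ≤ d and let v_1,…,v_n be non-negative real numbers. Assume one of the following: (1) m < n, the sequence (v_i) is monotone non-increasing, and (1/m)·Σ_{i=1}^m (v_i − 1) ≥ (1/(d−m))·Σ_{i=m+1}^n v_i; or (2) m ≥ n, v_i ≥ 1 for all 1 ≤ i ≤ n−1, and Σ_{i=1}^n v_i ≥ m. Then Σ_{i=1}^n v_i·α_i − Σ_{i=1}^d α_i⁺ ≥ 0. -/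
/-- Lemma 4.9 (general formal inequality): for weakly decreasing `α` summing to
zero with sign change at `m`, and non-negative coefficients `v_1,…,v_n`
satisfying either condition (1) or condition (2),
`Σ_{i=1}^n v_i·α_i − Σ_{i=1}^d α_i⁺ ≥ 0`. -/
theorem stmt_16 (d n m : ℕ) (hd : 2 ≤ d)
    (α : ℕ → ℝ) (hmono : ∀ i ∈ Finset.Icc 1 (d - 1), α (i + 1) ≤ α i)
    (hsum : ∑ i ∈ Finset.Icc 1 d, α i = 0)
    (hm1 : 1 ≤ m) (hmd : m ≤ d - 1) (hsgn1 : 0 ≤ α m) (hsgn2 : α (m + 1) ≤ 0)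
    (hn1 : 1 ≤ n) (hnd : n ≤ d)
    (v : ℕ → ℝ) (hv : ∀ i ∈ Finset.Icc 1 n, 0 ≤ v i)
    (hyp :
      (m < n ∧ (∀ i j, 1 ≤ i → i ≤ j → j ≤ n → v j ≤ v i) ∧
        (1 / ((d : ℝ) - (m : ℝ))) * ∑ i ∈ Finset.Icc (m + 1) n, v i
          ≤ (1 / (m : ℝ)) * ∑ i ∈ Finset.Icc 1 m, (v i - 1))
      ∨ (n ≤ m ∧ (∀ i ∈ Finset.Icc 1 (n - 1), 1 ≤ v i) ∧
        (m : ℝ) ≤ ∑ i ∈ Finset.Icc 1 n, v i)) :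
    0 ≤ (∑ i ∈ Finset.Icc 1 n, v i * α i) - ∑ i ∈ Finset.Icc 1 d, max (α i) 0 := by
  have anti : ∀ i j, 1 ≤ i → i ≤ j → j ≤ d → α j ≤ α i := by
    intro i j hi hij
    induction j, hij using Nat.le_induction with
    | base => intro _; exact le_rfl
    | succ k hk ih =>
      intro hkd
      exact (hmono k (Finset.mem_Icc.2 ⟨by omega, by omega⟩)).trans (ih (by omega))
  have split : ∀ (f : ℕ → ℝ) (a b : ℕ), a ≤ b →
      ∑ i ∈ Finset.Icc 1 b, f i = ∑ i ∈ Finset.Icc 1 a, f i + ∑ i ∈ Finset.Icc (a + 1) b, f i := by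
    intro f a b hab
    rw [← Finset.sum_union]
    · congr 1
      ext x
      simp only [Finset.mem_union, Finset.mem_Icc]
      omega
    · rw [Finset.disjoint_left]
      intro x hx hy
      simp only [Finset.mem_Icc] at hx hy
      omega
  have hpos : ∑ i ∈ Finset.Icc 1 d, max (α i) 0 = ∑ i ∈ Finset.Icc 1 m, α i := by
    rw [split _ m d (by omega)]
    have h1 : ∑ i ∈ Finset.Icc 1 m, max (α i) 0 = ∑ i ∈ Finset.Icc 1 m, α i := by
      apply Finset.sum_congr rfl
      intro i hi
      rw [Finset.mem_Icc] at hi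
      exact max_eq_left (hsgn1.trans (anti i m hi.1 hi.2 (by omega)))
    have h2 : ∑ i ∈ Finset.Icc (m + 1) d, max (α i) 0 = 0 := by
      apply Finset.sum_eq_zero
      intro i hi
      rw [Finset.mem_Icc] at hi
      exact max_eq_right ((anti (m + 1) i (by omega) hi.1 hi.2).trans hsgn2)
    rw [h1, h2, add_zero]
  have hP : 0 ≤ ∑ i ∈ Finset.Icc 1 m, α i := by
    apply Finset.sum_nonneg
    intro i hi
    rw [Finset.mem_Icc] at hi
    exact hsgn1.trans (anti i m hi.1 hi.2 (by omega))
  rw [hpos]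
  rcases hyp with ⟨hmn, hvm, hle⟩ | ⟨hnm, hv1, hle⟩
  · have hmR : (0 : ℝ) < m := by exact_mod_cast hm1
    have hdR : (0 : ℝ) < (d : ℝ) - m := by
      have : (m : ℝ) < d := by exact_mod_cast (show m < d by omega)
      linarith
    have c1 := MonovaryOn.sum_mul_sum_le_card_mul_sum (s := Finset.Icc 1 m) (f := v) (g := α) (by
      intro i hi j hj hlt
      simp only [Finset.coe_Icc, Set.mem_Icc] at hi hj
      have : j ≤ i := by
        by_contra hc
        exact absurd (anti i j hi.1 (by omega) (by omega)) (not_le.2 hlt)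
      exact hvm j i hj.1 this (by omega))
    have c2 := MonovaryOn.sum_mul_sum_le_card_mul_sum (s := Finset.Icc (m + 1) d)
      (f := fun i => if i ≤ n then v i else 0) (g := α) (by
      intro i hi j hj hlt
      simp only [Finset.coe_Icc, Set.mem_Icc] at hi hj
      have hji : j ≤ i := by
        by_contra hc
        exact absurd (anti i j (by omega) (by omega) (by omega)) (not_le.2 hlt)
      show (if i ≤ n then v i else 0) ≤ (if j ≤ n then v j else 0)
      by_cases h1 : i ≤ n
      · rw [if_pos h1, if_pos (hji.trans h1)]
        exact hvm j i (by omega) hji h1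
      · rw [if_neg h1]
        split_ifs with h2
        · exact hv j (Finset.mem_Icc.2 ⟨by omega, h2⟩)
        · exact le_rfl)
    have hfil : (Finset.Icc (m + 1) d).filter (fun i => i ≤ n) = Finset.Icc (m + 1) n := by
      ext x
      simp only [Finset.mem_filter, Finset.mem_Icc]
      omega
    simp only [ite_mul, zero_mul] at c2
    rw [← Finset.sum_filter, ← Finset.sum_filter, hfil] at c2
    rw [Nat.card_Icc] at c1 c2
    have e2 : ((d + 1 - (m + 1) : ℕ) : ℝ) = (d : ℝ) - m := by
      rw [Nat.add_sub_add_right, Nat.cast_sub (by omega)]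
    rw [e2] at c2
    rw [Nat.add_sub_cancel] at c1
    have hneg : ∑ i ∈ Finset.Icc (m + 1) d, α i = - ∑ i ∈ Finset.Icc 1 m, α i := by
      have := split α m d (by omega)
      linarith
    rw [hneg] at c2
    rw [split _ m n hmn.le]
    rw [Finset.sum_sub_distrib] at hle
    simp only [Finset.sum_const, Nat.card_Icc, Nat.add_sub_cancel, nsmul_eq_mul, mul_one] at hle
    generalize ∑ i ∈ Finset.Icc 1 m, α i = P at *
    generalize ∑ i ∈ Finset.Icc 1 m, v i = V at *
    generalize ∑ i ∈ Finset.Icc (m + 1) n, v i = W at *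
    generalize ∑ i ∈ Finset.Icc 1 m, v i * α i = A at *
    generalize ∑ i ∈ Finset.Icc (m + 1) n, v i * α i = B at *
    have a1 : V * P / m ≤ A := by rw [div_le_iff₀ hmR]; linarith
    have a2 : W * -P / ((d : ℝ) - m) ≤ B := by rw [div_le_iff₀ hdR]; linarith
    have a3 := mul_le_mul_of_nonneg_right hle hP
    have e3 : 1 / (m : ℝ) * (V - m) * P = V * P / m - P := by field_simp
    have e4 : 1 / ((d : ℝ) - m) * W * P = - (W * -P / ((d : ℝ) - m)) := by ring
    rw [e3, e4] at a3
    linarith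
  · have hαn : 0 ≤ α n := hsgn1.trans (anti n m hn1 hnm (by omega))
    rw [split α n m hnm]
    have b1 : ∑ i ∈ Finset.Icc (n + 1) m, α i ≤ ((m : ℝ) - n) * α n := by
      have := Finset.sum_le_card_nsmul (Finset.Icc (n + 1) m) α (α n) (by
        intro i hi
        rw [Finset.mem_Icc] at hi
        exact anti n i hn1 (by omega) (by omega))
      rw [Nat.card_Icc, Nat.add_sub_add_right, nsmul_eq_mul, Nat.cast_sub hnm] at this
      exact this
    have b2 : ∑ i ∈ Finset.Icc 1 n, (v i - 1) * α n ≤ ∑ i ∈ Finset.Icc 1 n, (v i - 1) * α i := by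
      apply Finset.sum_le_sum
      intro i hi
      rw [Finset.mem_Icc] at hi
      rcases eq_or_ne i n with rfl | hne
      · exact le_rfl
      · have := hv1 i (Finset.mem_Icc.2 ⟨hi.1, by omega⟩)
        exact mul_le_mul_of_nonneg_left (anti i n hi.1 hi.2 hnd) (by linarith)
    rw [← Finset.sum_mul, Finset.sum_sub_distrib] at b2
    simp only [sub_mul, one_mul, Finset.sum_sub_distrib, Finset.sum_const, Nat.card_Icc,
      Nat.add_sub_cancel, nsmul_eq_mul, mul_one] at b2
    have b3 := mul_le_mul_of_nonneg_right hle hαn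
    linarith
end

section
/- Let d ≥ 2, let α ∈ ℝ^d satisfy α_i ≥ α_{i+1} for all 1 ≤ i ≤ d−1 and Σ_{i=1}^d α_i = 0, and let m be an integer with 1 ≤ m ≤ d−1 and α_m ≥ 0 ≥ α_{m+1}. Let κ ∈ [0,1), and let s ≥ 1 and t ≥ 2 be integers with s + t ≤ d. Define v_1,…,v_{s+t} by: v_{s+t} = κ, v_{s+t−1} = 1, v_i = v_{i+2} + 1 for s ≤ i ≤ s+t−2, and v_i = v_s for 1 ≤ i < s. Let S = Σ_{i=1}^{s+t} v_i. Assume one of the following: (1) m < s+t ≤ d−1 and (S − v_1)/(d−1) ≤ v_1 − 1; or (2) m ≥ s+t and S ≥ m. Then Σ_{i=1}^{s+t} v_i·α_i − Σ_{i=1}^d α_i⁺ ≥ 0. -/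
lemma anti_aux (f : ℕ → ℝ) (d : ℕ) (h : ∀ i, 1 ≤ i → i < d → f (i + 1) ≤ f i) :
    ∀ i j, 1 ≤ i → i ≤ j → j ≤ d → f j ≤ f i := by
  intro i j hi hij
  induction j, hij using Nat.le_induction with
  | base => intro _; exact le_rfl
  | succ k hk ih => intro hkd; exact (h k (by omega) (by omega)).trans (ih (by omega))

lemma cheb (f g : ℕ → ℝ) (a b d : ℕ) (hab : a ≤ b) (hb : b ≤ d)
    (hf : ∀ i j, 1 ≤ i → i ≤ j → j ≤ d → f j ≤ f i)
    (hg : ∀ i j, 1 ≤ i → i ≤ j → j ≤ d → g j ≤ g i) :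
    (∑ i ∈ Finset.Ioc a b, f i) * (∑ i ∈ Finset.Ioc a b, g i)
      ≤ ((b : ℝ) - a) * ∑ i ∈ Finset.Ioc a b, f i * g i := by
  have hmv : MonovaryOn f g (Finset.Ioc a b : Finset ℕ) := by
    intro i hi j hj hij
    simp only [Finset.coe_Ioc, Set.mem_Ioc] at hi hj
    rcases le_total i j with h | h
    · exact absurd (hg i j (by omega) h (by omega)) (not_le.mpr hij)
    · exact hf j i (by omega) h (by omega)
  have := hmv.sum_mul_sum_le_card_mul_sum
  rwa [Nat.card_Ioc, Nat.cast_sub hab] at this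

lemma head_ge (f : ℕ → ℝ) (m d : ℕ) (hmd : m ≤ d)
    (hf : ∀ i j, 1 ≤ i → i ≤ j → j ≤ d → f j ≤ f i) :
    (m : ℝ) * f m ≤ ∑ i ∈ Finset.Ioc 0 m, f i := by
  have := Finset.card_nsmul_le_sum (Finset.Ioc 0 m) f (f m) (by
    intro i hi
    simp only [Finset.mem_Ioc] at hi
    exact hf i m (by omega) hi.2 hmd)
  simpa using this

set_option maxHeartbeats 1000000 in
/-- Proposition 4.10: for the coefficients `v_1,…,v_{s+t}` defined by the
backwards recursion `v_{s+t} = κ`, `v_{s+t−1} = 1`, `v_i = v_{i+2} + 1` for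
`s ≤ i ≤ s+t−2`, `v_i = v_s` for `1 ≤ i < s`, and `S = Σ_{i=1}^{s+t} v_i`,
if either (1) `m < s+t ≤ d−1` and `(S − v_1)/(d−1) ≤ v_1 − 1`, or
(2) `m ≥ s+t` and `S ≥ m`, then `Σ_{i=1}^{s+t} v_i·α_i − Σ_{i=1}^d α_i⁺ ≥ 0`. -/
theorem stmt_17 (d s t m : ℕ) (hd : 2 ≤ d)
    (α : ℕ → ℝ) (hmono : ∀ i ∈ Finset.Icc 1 (d - 1), α (i + 1) ≤ α i)
    (hsum : ∑ i ∈ Finset.Icc 1 d, α i = 0)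
    (hm1 : 1 ≤ m) (hmd : m ≤ d - 1) (hsgn1 : 0 ≤ α m) (hsgn2 : α (m + 1) ≤ 0)
    (κ : ℝ) (hκ0 : 0 ≤ κ) (hκ1 : κ < 1)
    (hs : 1 ≤ s) (ht : 2 ≤ t) (hstd : s + t ≤ d)
    (v : ℕ → ℝ)
    (hv1 : v (s + t) = κ) (hv2 : v (s + t - 1) = 1)
    (hv3 : ∀ i, s ≤ i → i ≤ s + t - 2 → v i = v (i + 2) + 1)
    (hv4 : ∀ i, 1 ≤ i → i < s → v i = v s)
    (hyp :
      (m < s + t ∧ s + t ≤ d - 1 ∧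
        ((∑ i ∈ Finset.Icc 1 (s + t), v i) - v 1) / ((d : ℝ) - 1) ≤ v 1 - 1)
      ∨ (s + t ≤ m ∧ (m : ℝ) ≤ ∑ i ∈ Finset.Icc 1 (s + t), v i)) :
    0 ≤ (∑ i ∈ Finset.Icc 1 (s + t), v i * α i) - ∑ i ∈ Finset.Icc 1 d, max (α i) 0 := by
  have hI : ∀ k, Finset.Icc 1 k = Finset.Ioc 0 k := fun k => rfl
  simp only [hI] at hmono hsum hyp ⊢
  have ha : ∀ i j, 1 ≤ i → i ≤ j → j ≤ d → α j ≤ α i :=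
    anti_aux α d (fun i h1 h2 => hmono i (by simp only [Finset.mem_Ioc]; omega))
  obtain ⟨n, hn⟩ : ∃ n, n = s + t := ⟨_, rfl⟩
  rw [← hn] at hstd hv1 hv2 hv3 hyp ⊢
  -- values of v
  have hval : ∀ p : ℕ, (2 * p ≤ t → v (n - 2 * p) = κ + p) ∧
      (2 * p + 1 ≤ t → v (n - (2 * p + 1)) = p + 1) := by
    intro p
    induction p with
    | zero => simp [hv1, hv2]
    | succ p ih =>
      constructor
      · intro h
        rw [hv3 _ (by omega) (by omega), show n - 2 * (p + 1) + 2 = n - 2 * p by omega,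
          ih.1 (by omega)]
        push_cast; ring
      · intro h
        rw [hv3 _ (by omega) (by omega),
          show n - (2 * (p + 1) + 1) + 2 = n - (2 * p + 1) by omega, ih.2 (by omega)]
        push_cast; ring
  have hstep : ∀ i, 1 ≤ i → i < n → v (i + 1) ≤ v i := by
    intro i h1 h2
    rcases lt_or_ge i s with h | h
    · rw [hv4 i h1 h]
      rcases Nat.lt_or_ge (i + 1) s with h' | h'
      · rw [hv4 _ (by omega) h']
      · rw [show i + 1 = s by omega]
    · obtain ⟨p, hp | hp⟩ : ∃ p, n - i = 2 * p ∨ n - i = 2 * p + 1 := ⟨(n - i) / 2, by omega⟩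
      · obtain ⟨q, rfl⟩ : ∃ q, p = q + 1 := ⟨p - 1, by omega⟩
        have e1 := (hval (q + 1)).1 (by omega)
        have e2 := (hval q).2 (by omega)
        rw [show n - 2 * (q + 1) = i by omega] at e1
        rw [show n - (2 * q + 1) = i + 1 by omega] at e2
        rw [e1, e2]; push_cast; linarith
      · have e1 := (hval p).2 (by omega)
        have e2 := (hval p).1 (by omega)
        rw [show n - (2 * p + 1) = i by omega] at e1
        rw [show n - 2 * p = i + 1 by omega] at e2
        rw [e1, e2]; linarith
  have hva := anti_aux v n hstep
  -- positive part sum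
  have hpos : ∑ i ∈ Finset.Ioc 0 d, max (α i) 0 = ∑ i ∈ Finset.Ioc 0 m, α i := by
    rw [← Finset.sum_Ioc_consecutive _ (Nat.zero_le m) (by omega : m ≤ d)]
    have e1 : ∑ i ∈ Finset.Ioc 0 m, max (α i) 0 = ∑ i ∈ Finset.Ioc 0 m, α i := by
      refine Finset.sum_congr rfl fun i hi => ?_
      simp only [Finset.mem_Ioc] at hi
      exact max_eq_left (hsgn1.trans (ha i m (by omega) hi.2 (by omega)))
    have e2 : ∑ i ∈ Finset.Ioc m d, max (α i) 0 = 0 := by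
      refine Finset.sum_eq_zero fun i hi => ?_
      simp only [Finset.mem_Ioc] at hi
      exact max_eq_right ((ha (m + 1) i (by omega) (by omega) hi.2).trans hsgn2)
    rw [e1, e2, add_zero]
  rw [hpos]
  have hanonneg : ∀ i, 1 ≤ i → i ≤ m → 0 ≤ α i := fun i h1 h2 =>
    hsgn1.trans (ha i m h1 h2 (by omega))
  rcases hyp with ⟨hmn, hnd, hS⟩ | ⟨hnm, hS⟩
  · -- case 1
    have hS' := Finset.sum_Ioc_consecutive v (Nat.zero_le m) hmn.le
    have hSa := Finset.sum_Ioc_consecutive (fun i => v i * α i) (Nat.zero_le m) hmn.le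
    have hAa := Finset.sum_Ioc_consecutive α (Nat.zero_le m) (by omega : m ≤ d)
    have hA0 : 0 ≤ ∑ i ∈ Finset.Ioc 0 m, α i := Finset.sum_nonneg fun i hi => by
      simp only [Finset.mem_Ioc] at hi
      exact hanonneg i (by omega) hi.2
    -- key inequality
    have hkey : (m : ℝ) * (∑ i ∈ Finset.Ioc m n, v i) ≤
        ((∑ i ∈ Finset.Ioc 0 m, v i) - m) * ((d : ℝ) - m) := by
      rcases Nat.lt_or_ge s m with hsm | hsm
      · have htail : ∀ p : ℕ, (2 * p ≤ t → ∑ i ∈ Finset.Ioc (n - 2 * p) n, v i = p * (κ + p)) ∧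
            (2 * p + 1 ≤ t → ∑ i ∈ Finset.Ioc (n - (2 * p + 1)) n, v i = (p + 1) * (κ + p)) := by
          have hs1 : ∀ j, j < n → ∑ i ∈ Finset.Ioc (n - (j + 1)) n, v i =
              v (n - j) + ∑ i ∈ Finset.Ioc (n - j) n, v i := by
            intro j hj
            rw [← Finset.sum_Ioc_consecutive v (show n - (j + 1) ≤ n - j by omega)
              (show n - j ≤ n by omega)]
            rw [show n - j = n - (j + 1) + 1 by omega, Finset.sum_Ioc_succ_top le_rfl]
            simp
          have odd : ∀ p : ℕ, (2 * p ≤ t → ∑ i ∈ Finset.Ioc (n - 2 * p) n, v i = p * (κ + p)) →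
            (2 * p + 1 ≤ t → ∑ i ∈ Finset.Ioc (n - (2 * p + 1)) n, v i = (p + 1) * (κ + p)) := by
            intro p h hp
            rw [hs1 _ (by omega), h (by omega), (hval p).1 (by omega)]
            ring
          intro p
          induction p with
          | zero => exact ⟨by simp, odd 0 (by simp)⟩
          | succ p ih =>
            have : 2 * (p + 1) ≤ t →
                ∑ i ∈ Finset.Ioc (n - 2 * (p + 1)) n, v i = (p + 1 : ℕ) * (κ + (p + 1 : ℕ)) := by
              intro h
              rw [show 2 * (p + 1) = (2 * p + 1) + 1 by ring, hs1 _ (by omega), ih.2 (by omega),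
                (hval p).2 (by omega)]
              push_cast; ring
            exact ⟨this, odd _ this⟩
        have h1 := head_ge v m n hmn.le hva
        have h2 := head_ge v (m - 1) n (by omega) hva
        have h3 : ∑ i ∈ Finset.Ioc 0 m, v i = (∑ i ∈ Finset.Ioc 0 (m - 1), v i) + v m := by
          obtain ⟨k, rfl⟩ : ∃ k, m = k + 1 := ⟨m - 1, by omega⟩
          rw [Finset.sum_Ioc_succ_top (Nat.zero_le k)]; simp
        rw [Nat.cast_sub hm1, Nat.cast_one] at h2
        have hm2 : (2 : ℝ) ≤ m := by exact_mod_cast (by omega : 2 ≤ m)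
        -- enough with j+1
        suffices h : 0 ≤ (∑ i ∈ Finset.Ioc 0 m, v i) - m ∧ (m : ℝ) * (∑ i ∈ Finset.Ioc m n, v i) ≤
            ((∑ i ∈ Finset.Ioc 0 m, v i) - m) * ((n : ℝ) - m + 1) by
          refine h.2.trans (mul_le_mul_of_nonneg_left ?_ h.1)
          have : (n : ℝ) + 1 ≤ d := by exact_mod_cast (by omega : n + 1 ≤ d)
          linarith
        obtain ⟨p, hp | hp⟩ : ∃ p, n - m = 2 * p ∨ n - m = 2 * p + 1 := ⟨(n - m) / 2, by omega⟩
        · have e1 := (hval p).1 (by omega)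
          have e3 := (htail p).1 (by omega)
          have e2 := (hval p).2 (by omega)
          rw [show n - (2 * p + 1) = m - 1 by omega] at e2
          rw [show n - 2 * p = m by omega] at e1 e3
          have hnm : (n : ℝ) - m = 2 * p := by
            have : (n : ℝ) = 2 * p + m := by exact_mod_cast (by omega : n = 2 * p + m)
            linarith
          rw [e3, hnm]
          rw [e1] at h1 h3
          rw [e2] at h2
          generalize (∑ i ∈ Finset.Ioc 0 m, v i) = V at *
          have hp1 : 1 ≤ p := by omega
          rcases hp1.eq_or_lt with rfl | hp2
          · clear hval htail
            simp only [Nat.cast_one, Nat.cast_add, zero_add, Nat.cast_one, mul_one, mul_zero, add_zero, one_mul] at h1 h2 h3 ⊢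
            generalize (∑ i ∈ Finset.Ioc 0 (m - 1), v i) = W at *
            generalize (m : ℝ) = M at *
            have hk : 0 ≤ (M - 2) * (1 - κ) := mul_nonneg (by linarith) (by linarith)
            have hk' : 0 ≤ (M - 2) * κ := mul_nonneg (by linarith) hκ0
            constructor <;> nlinarith
          · have hp2 : (2 : ℝ) ≤ p := by exact_mod_cast hp2
            generalize (p : ℝ) = P at *
            generalize (m : ℝ) = M at *
            constructor
            · nlinarith
            · have : (M * (κ + P) - M) * (2 * P + 1) ≤ (V - M) * (2 * P + 1) :=
                mul_le_mul_of_nonneg_right (by linarith) (by linarith)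
              refine le_trans ?_ this
              have : 0 ≤ M * ((κ + P) * (P + 1) - (2 * P + 1)) :=
                mul_nonneg (by linarith) (by nlinarith)
              nlinarith
        · have e1 := (hval p).2 (by omega)
          have e3 := (htail p).2 (by omega)
          have e2 := (hval (p + 1)).1 (by omega)
          rw [show n - 2 * (p + 1) = m - 1 by omega] at e2
          rw [show n - (2 * p + 1) = m by omega] at e1 e3
          have hnm : (n : ℝ) - m = 2 * p + 1 := by
            have : (n : ℝ) = 2 * p + 1 + m := by exact_mod_cast (by omega : n = 2 * p + 1 + m)
            linarith
          rw [e3, hnm]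
          rw [e1] at h1 h3
          rw [e2] at h2
          generalize (∑ i ∈ Finset.Ioc 0 m, v i) = V at *
          rcases Nat.eq_zero_or_pos p with rfl | hp2
          · clear hval htail
            simp only [Nat.cast_zero, Nat.cast_add, zero_add, Nat.cast_one, mul_one, mul_zero, add_zero, one_mul] at h1 h2 h3 ⊢
            generalize (∑ i ∈ Finset.Ioc 0 (m - 1), v i) = W at *
            generalize (m : ℝ) = M at *
            have hk : 0 ≤ (M - 2) * (1 - κ) := mul_nonneg (by linarith) (by linarith)
            have hk' : 0 ≤ (M - 2) * κ := mul_nonneg (by linarith) hκ0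
            constructor <;> nlinarith
          · have hp2 : (1 : ℝ) ≤ p := by exact_mod_cast hp2
            generalize (p : ℝ) = P at *
            generalize (m : ℝ) = M at *
            constructor
            · nlinarith
            · have : (M * (P + 1) - M) * (2 * P + 1 + 1) ≤ (V - M) * (2 * P + 1 + 1) :=
                mul_le_mul_of_nonneg_right (by linarith) (by linarith)
              refine le_trans ?_ this
              have : 0 ≤ M * ((P + 1) * (P - κ)) :=
                mul_nonneg (by linarith) (mul_nonneg (by linarith) (by linarith))
              nlinarith
      · have hc : ∀ i, 1 ≤ i → i ≤ s → v i = v 1 := by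
          have : ∀ i, 1 ≤ i → i ≤ s → v i = v s := by
            intro i h1 h2
            rcases h2.eq_or_lt with rfl | h
            · rfl
            · exact hv4 i h1 h
          intro i h1 h2
          rw [this i h1 h2, this 1 le_rfl hs]
        have hV : ∑ i ∈ Finset.Ioc 0 m, v i = m * v 1 := by
          rw [Finset.sum_congr rfl (g := fun _ => v 1)]
          · simp
          · intro i hi
            simp only [Finset.mem_Ioc] at hi
            exact hc i (by omega) (by omega)
        have hd1 : (0 : ℝ) < (d : ℝ) - 1 := by
          have : (2 : ℝ) ≤ d := by exact_mod_cast hd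
          linarith
        rw [div_le_iff₀ hd1] at hS
        have hm0 : (1 : ℝ) ≤ m := by exact_mod_cast hm1
        have hT : (∑ i ∈ Finset.Ioc m n, v i) ≤ (v 1 - 1) * ((d : ℝ) - m) := by
          rw [hV] at hS'
          nlinarith
        rw [hV]
        have := mul_le_mul_of_nonneg_left hT (by linarith : (0 : ℝ) ≤ m)
        nlinarith
    -- Chebyshev
    have c1 := cheb v α 0 m n (Nat.zero_le m) hmn.le hva
      (fun i j h1 h2 h3 => ha i j h1 h2 (by omega))
    have hvn : ∀ i, 1 ≤ i → i ≤ n → 0 ≤ v i := fun i h1 h2 => by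
      have := hva i n h1 h2 le_rfl
      linarith
    have c2 := cheb (fun i => if i ≤ n then v i else 0) α m d d (by omega) le_rfl (by
      intro i j h1 h2 h3
      split_ifs with h4 h5 h5
      · exact hva i j h1 h2 h4
      · omega
      · exact hvn i h1 h5
      · exact le_rfl) ha
    have w1 : ∑ i ∈ Finset.Ioc m d, (if i ≤ n then v i else 0) = ∑ i ∈ Finset.Ioc m n, v i := by
      rw [← Finset.sum_filter]
      congr 1
      ext i
      simp only [Finset.mem_filter, Finset.mem_Ioc]; omega
    have w2 : ∑ i ∈ Finset.Ioc m d, (if i ≤ n then v i else 0) * α i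
        = ∑ i ∈ Finset.Ioc m n, v i * α i := by
      simp only [ite_mul, zero_mul]
      rw [← Finset.sum_filter]
      congr 1
      ext i
      simp only [Finset.mem_filter, Finset.mem_Ioc]; omega
    rw [w1, w2] at c2
    rw [← hSa]
    have hB : ∑ i ∈ Finset.Ioc m d, α i = -∑ i ∈ Finset.Ioc 0 m, α i := by linarith
    rw [hB] at c2
    have hm0 : (0 : ℝ) < m := by exact_mod_cast hm1
    have hdm : (0 : ℝ) < (d : ℝ) - m := by
      have : (m : ℝ) + 1 ≤ d := by exact_mod_cast (by omega : m + 1 ≤ d)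
      linarith
    rw [Nat.cast_zero, sub_zero] at c1
    clear hS hS' hSa hAa
    generalize (∑ i ∈ Finset.Ioc 0 m, v i) = V at *
    generalize (∑ i ∈ Finset.Ioc m n, v i) = T at *
    generalize (∑ i ∈ Finset.Ioc 0 m, v i * α i) = X at *
    generalize (∑ i ∈ Finset.Ioc m n, v i * α i) = Y at *
    generalize (∑ i ∈ Finset.Ioc 0 m, α i) = A at *
    generalize (d : ℝ) - m = D at *
    generalize (m : ℝ) = M at *
    have k1 := mul_le_mul_of_nonneg_left c1 hdm.le
    have k2 := mul_le_mul_of_nonneg_left c2 hm0.le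
    have k3 := mul_le_mul_of_nonneg_right hkey hA0
    have : 0 ≤ (M * D) * (X + Y - A) := by nlinarith
    exact nonneg_of_mul_nonneg_right this (mul_pos hm0 hdm)
  · -- case 2
    rw [← Finset.sum_Ioc_consecutive α (Nat.zero_le n) hnm]
    have hc0 : 0 ≤ α n := hanonneg n (by omega) hnm
    have h1 : ∑ i ∈ Finset.Ioc 0 n, (v i - 1) * α n ≤ ∑ i ∈ Finset.Ioc 0 n, (v i - 1) * α i := by
      refine Finset.sum_le_sum fun i hi => ?_
      simp only [Finset.mem_Ioc] at hi
      rcases hi.2.eq_or_lt with rfl | h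
      · exact le_rfl
      · have := hva i (n - 1) (by omega) (by omega) (by omega)
        exact mul_le_mul_of_nonneg_left (ha i n (by omega) hi.2 (by omega)) (by linarith)
    have h2 : ∑ i ∈ Finset.Ioc n m, α i ≤ ∑ i ∈ Finset.Ioc n m, α n := by
      refine Finset.sum_le_sum fun i hi => ?_
      simp only [Finset.mem_Ioc] at hi
      exact ha n i (by omega) (by omega) (by omega)
    rw [← Finset.sum_mul, Finset.sum_sub_distrib] at h1
    simp only [sub_mul, one_mul, Finset.sum_sub_distrib, Finset.sum_const, Nat.card_Ioc,
      nsmul_eq_mul, Nat.sub_zero, mul_one, Nat.cast_sub hnm] at h1 h2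
    have h3 := mul_nonneg (sub_nonneg.mpr hS) hc0
    nlinarith
end
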